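/- Main theorem for A_{2n−1}^(2) (Theorem 5.1): Let n ≥ 2 and l, k ≥ 1. Let ι : B_l ⊗ B_k → B_k ⊗ B_l be any isomorphism of U_q'(A_{2n−1}^(2)) crystals and let H be any energy function for ι. For every b_1 ⊗ b_2 ∈ B_l ⊗ B_k, let b'_2 ∈ B_k, b'_1 ∈ B_l and the integers l', k', m be produced by Rule (A). Then ι(b_1 ⊗ b_2) = b'_2 ⊗ b'_1 and H(b_1 ⊗ b_2) = 2·min(l', k') − m. -/

import Mathlib

namespace KTT

/-- Raw data of a crystal element `(x_1,…,x_n,x̄_n,…,x̄_1)`: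
`b.1 i` is `x_{i+1}` and `b.2 i` is `x̄_{i+1}` for `i : Fin n`. -/
abbrev Tup (n : ℕ) := (Fin n → ℕ) × (Fin n → ℕ)

/-- The entry `x_j` (for `1 ≤ j ≤ n`). -/
def xc {n : ℕ} (b : Tup n) (j : ℕ) : ℕ :=
  if h : j - 1 < n then b.1 ⟨j - 1, h⟩ else 0

/-- The entry `x̄_j` (for `1 ≤ j ≤ n`). -/
def xbc {n : ℕ} (b : Tup n) (j : ℕ) : ℕ :=
  if h : j - 1 < n then b.2 ⟨j - 1, h⟩ else 0

/-- Set the entry indexed by `j` (i.e. `x_j`) to the value `v`. -/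
def setx {n : ℕ} (f : Fin n → ℕ) (j v : ℕ) : Fin n → ℕ :=
  fun t => if (t : ℕ) + 1 = j then v else f t

/-- `Σ_{i=1}^n (x_i + x̄_i)`. -/
def tsum {n : ℕ} (b : Tup n) : ℕ := ∑ i, (b.1 i + b.2 i)

/-- The element `(v,0,…,0)`. -/
def uvec (n v : ℕ) : Tup n := (fun j => if (j : ℕ) = 0 then v else 0, fun _ => 0)

/-- The element `(0,v,---,0)` (only `x_2 = v` nonzero). -/
def u2vec (n v : ℕ) : Tup n := (fun j => if (j : ℕ) = 1 then v else 0, fun _ => 0)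

/-- The element `(0,0,---,v)` (only `x̄_1 = v` nonzero). -/
def barvec (n v : ℕ) : Tup n := (fun _ => 0, fun j => if (j : ℕ) = 0 then v else 0)

/-- The element `(a,c,---,d)` with `x_1 = a`, `x_2 = c`, `x̄_1 = d`, all else `0`. -/
def tripleVec (n a c d : ℕ) : Tup n :=
  (fun j => if (j : ℕ) = 0 then a else if (j : ℕ) = 1 then c else 0,
   fun j => if (j : ℕ) = 0 then d else 0)

/-! ### The `U_q'(C_n^{(1)})` crystal `B_l` -/

/-- Membership in the `C_n^{(1)}` crystal `B_l` : the sum of the entries belongs to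
`{l, l-2, l-4, …}`. -/
def memC (n l : ℕ) (b : Tup n) : Prop := tsum b ≤ l ∧ (l - tsum b) % 2 = 0

def BC (n l : ℕ) : Set (Tup n) := {b | memC n l b}

/-- The number `x_0(b)` of `(0,0̄)` pairs. -/
def x0 (l : ℕ) {n : ℕ} (b : Tup n) : ℕ := (l - tsum b) / 2

/-- The operator `ẽ_i` on `B_l` (C case); `none` plays the role of `0`. -/
def eC (n l i : ℕ) (b : Tup n) : Option (Tup n) :=
  if i = 0 then
    if 0 < n then
      if xbc b 1 + 2 ≤ xc b 1 then some (setx b.1 1 (xc b 1 - 2), b.2)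
      else if xc b 1 = xbc b 1 + 1 then
        some (setx b.1 1 (xc b 1 - 1), setx b.2 1 (xbc b 1 + 1))
      else if tsum b + 2 ≤ l then some (b.1, setx b.2 1 (xbc b 1 + 2))
      else none
    else none
  else if i = n then
    if 0 < xbc b n then some (setx b.1 n (xc b n + 1), setx b.2 n (xbc b n - 1))
    else none
  else if i < n then
    if xbc b (i + 1) < xc b (i + 1) then
      some (setx (setx b.1 i (xc b i + 1)) (i + 1) (xc b (i + 1) - 1), b.2)
    else if 0 < xbc b i then
      some (b.1, setx (setx b.2 (i + 1) (xbc b (i + 1) + 1)) i (xbc b i - 1))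
    else none
  else none

/-- The operator `f̃_i` on `B_l` (C case). -/
def fC (n l i : ℕ) (b : Tup n) : Option (Tup n) :=
  if i = 0 then
    if 0 < n then
      if xbc b 1 ≤ xc b 1 then
        if tsum b + 2 ≤ l then some (setx b.1 1 (xc b 1 + 2), b.2) else none
      else if xc b 1 + 1 = xbc b 1 then
        some (setx b.1 1 (xc b 1 + 1), setx b.2 1 (xbc b 1 - 1))
      else some (b.1, setx b.2 1 (xbc b 1 - 2))
    else none
  else if i = n then
    if 0 < xc b n then some (setx b.1 n (xc b n - 1), setx b.2 n (xbc b n + 1))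
    else none
  else if i < n then
    if xbc b (i + 1) ≤ xc b (i + 1) then
      if 0 < xc b i then
        some (setx (setx b.1 i (xc b i - 1)) (i + 1) (xc b (i + 1) + 1), b.2)
      else none
    else some (b.1, setx (setx b.2 (i + 1) (xbc b (i + 1) - 1)) i (xbc b i + 1))
  else none

def eCIter (n l i m : ℕ) (b : Tup n) : Option (Tup n) :=
  (fun o => Option.bind o (eC n l i))^[m] (some b)

def fCIter (n l i m : ℕ) (b : Tup n) : Option (Tup n) :=
  (fun o => Option.bind o (fC n l i))^[m] (some b)

/-- `ε_i(b) = max {m | ẽ_i^m b ≠ 0}` (C case). -/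
noncomputable def epsC (n l i : ℕ) (b : Tup n) : ℕ :=
  sSup {m | eCIter n l i m b ≠ none}

/-- `φ_i(b) = max {m | f̃_i^m b ≠ 0}` (C case). -/
noncomputable def phiC (n l i : ℕ) (b : Tup n) : ℕ :=
  sSup {m | fCIter n l i m b ≠ none}

/-- `ẽ_i` on the tensor product `B_l ⊗ B_k` (C case). -/
noncomputable def eTenC (n l k i : ℕ) (u : Tup n × Tup n) : Option (Tup n × Tup n) :=
  if epsC n k i u.2 ≤ phiC n l i u.1 then (eC n l i u.1).map (fun c => (c, u.2))
  else (eC n k i u.2).map (fun c => (u.1, c))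

/-- `f̃_i` on the tensor product `B_l ⊗ B_k` (C case). -/
noncomputable def fTenC (n l k i : ℕ) (u : Tup n × Tup n) : Option (Tup n × Tup n) :=
  if epsC n k i u.2 < phiC n l i u.1 then (fC n l i u.1).map (fun c => (c, u.2))
  else (fC n k i u.2).map (fun c => (u.1, c))

/-- `ι : B_l ⊗ B_k → B_k ⊗ B_l` is an isomorphism of `U_q'(C_n^{(1)})` crystals. -/
def IsIsoC (n l k : ℕ) (ι : Tup n × Tup n → Tup n × Tup n) : Prop :=
  Set.BijOn ι (BC n l ×ˢ BC n k) (BC n k ×ˢ BC n l) ∧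
  ∀ u ∈ BC n l ×ˢ BC n k, ∀ i ≤ n,
    Option.map ι (eTenC n l k i u) = eTenC n k l i (ι u) ∧
    Option.map ι (fTenC n l k i u) = fTenC n k l i (ι u)

/-- `H` is an energy function for the isomorphism `ι` (C case), normalized by
`H((l,0,…,0) ⊗ (0,k,---,0)) = 0`. -/
def IsEnergyC (n l k : ℕ) (ι : Tup n × Tup n → Tup n × Tup n)
    (H : Tup n × Tup n → ℤ) : Prop :=
  (∀ u ∈ BC n l ×ˢ BC n k, ∀ i ≤ n, ∀ v, eTenC n l k i u = some v →
      H v = H u +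
        (if i = 0 then
          (if epsC n k 0 u.2 ≤ phiC n l 0 u.1 ∧ epsC n l 0 (ι u).2 ≤ phiC n k 0 (ι u).1
           then 1
           else if phiC n l 0 u.1 < epsC n k 0 u.2 ∧ phiC n k 0 (ι u).1 < epsC n l 0 (ι u).2
           then -1 else 0)
         else 0)) ∧
  H (uvec n l, u2vec n k) = 0

/-! ### The `U_q'(A_{2n-1}^{(2)})` crystal `B_l` -/

def memA (n l : ℕ) (b : Tup n) : Prop := tsum b = l

def BA (n l : ℕ) : Set (Tup n) := {b | memA n l b}

/-- The operator `ẽ_i` (A case). -/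
def eA (n i : ℕ) (b : Tup n) : Option (Tup n) :=
  if i = 0 then
    if 1 < n then
      if xbc b 2 < xc b 2 then some (setx b.1 2 (xc b 2 - 1), setx b.2 1 (xbc b 1 + 1))
      else if 0 < xc b 1 then some (setx b.1 1 (xc b 1 - 1), setx b.2 2 (xbc b 2 + 1))
      else none
    else none
  else if i = n then
    if 0 < xbc b n then some (setx b.1 n (xc b n + 1), setx b.2 n (xbc b n - 1))
    else none
  else if i < n then
    if xbc b (i + 1) < xc b (i + 1) then
      some (setx (setx b.1 i (xc b i + 1)) (i + 1) (xc b (i + 1) - 1), b.2)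
    else if 0 < xbc b i then
      some (b.1, setx (setx b.2 (i + 1) (xbc b (i + 1) + 1)) i (xbc b i - 1))
    else none
  else none

/-- The operator `f̃_i` (A case). -/
def fA (n i : ℕ) (b : Tup n) : Option (Tup n) :=
  if i = 0 then
    if 1 < n then
      if xbc b 2 ≤ xc b 2 then
        if 0 < xbc b 1 then some (setx b.1 2 (xc b 2 + 1), setx b.2 1 (xbc b 1 - 1))
        else none
      else some (setx b.1 1 (xc b 1 + 1), setx b.2 2 (xbc b 2 - 1))
    else none
  else if i = n then
    if 0 < xc b n then some (setx b.1 n (xc b n - 1), setx b.2 n (xbc b n + 1))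
    else none
  else if i < n then
    if xbc b (i + 1) ≤ xc b (i + 1) then
      if 0 < xc b i then
        some (setx (setx b.1 i (xc b i - 1)) (i + 1) (xc b (i + 1) + 1), b.2)
      else none
    else some (b.1, setx (setx b.2 (i + 1) (xbc b (i + 1) - 1)) i (xbc b i + 1))
  else none

def eAIter (n i m : ℕ) (b : Tup n) : Option (Tup n) :=
  (fun o => Option.bind o (eA n i))^[m] (some b)

def fAIter (n i m : ℕ) (b : Tup n) : Option (Tup n) :=
  (fun o => Option.bind o (fA n i))^[m] (some b)

noncomputable def epsA (n i : ℕ) (b : Tup n) : ℕ :=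
  sSup {m | eAIter n i m b ≠ none}

noncomputable def phiA (n i : ℕ) (b : Tup n) : ℕ :=
  sSup {m | fAIter n i m b ≠ none}

/-- `ẽ_i` on a tensor product (A case). -/
noncomputable def eTenA (n i : ℕ) (u : Tup n × Tup n) : Option (Tup n × Tup n) :=
  if epsA n i u.2 ≤ phiA n i u.1 then (eA n i u.1).map (fun c => (c, u.2))
  else (eA n i u.2).map (fun c => (u.1, c))

/-- `f̃_i` on a tensor product (A case). -/
noncomputable def fTenA (n i : ℕ) (u : Tup n × Tup n) : Option (Tup n × Tup n) :=
  if epsA n i u.2 < phiA n i u.1 then (fA n i u.1).map (fun c => (c, u.2))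
  else (fA n i u.2).map (fun c => (u.1, c))

/-- `ι : B_l ⊗ B_k → B_k ⊗ B_l` is an isomorphism of `U_q'(A_{2n-1}^{(2)})` crystals. -/
def IsIsoA (n l k : ℕ) (ι : Tup n × Tup n → Tup n × Tup n) : Prop :=
  Set.BijOn ι (BA n l ×ˢ BA n k) (BA n k ×ˢ BA n l) ∧
  ∀ u ∈ BA n l ×ˢ BA n k, ∀ i ≤ n,
    Option.map ι (eTenA n i u) = eTenA n i (ι u) ∧
    Option.map ι (fTenA n i u) = fTenA n i (ι u)

/-- `H` is an energy function for `ι` (A case), normalized by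
`H((l,0,…,0) ⊗ (0,0,---,k)) = 0`. -/
def IsEnergyA (n l k : ℕ) (ι : Tup n × Tup n → Tup n × Tup n)
    (H : Tup n × Tup n → ℤ) : Prop :=
  (∀ u ∈ BA n l ×ˢ BA n k, ∀ i ≤ n, ∀ v, eTenA n i u = some v →
      H v = H u +
        (if i = 0 then
          (if epsA n 0 u.2 ≤ phiA n 0 u.1 ∧ epsA n 0 (ι u).2 ≤ phiA n 0 (ι u).1
           then 1
           else if phiA n 0 u.1 < epsA n 0 u.2 ∧ phiA n 0 (ι u).1 < epsA n 0 (ι u).2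
           then -1 else 0)
         else 0)) ∧
  H (uvec n l, barvec n k) = 0

/-! ### Words, tableaux and column insertion

Letters are encoded as natural numbers: the unbarred letter `j` (for `0 ≤ j ≤ n`) is `j`,
and the barred letter `j̄` is `2n+1-j`; the natural order of `ℕ` is the order
`0 < 1 < ⋯ < n < n̄ < ⋯ < 1̄ < 0̄`.  A (two-row) tableau is encoded as the list of its
columns (left to right), each column being the list of its entries (top to bottom). -/

/-- The barred partner `j̄` of an unbarred letter `j`. -/
def bar (n j : ℕ) : ℕ := 2 * n + 1 - j

/-- Column insertion of a letter into a tableau with at most two rows. -/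
def insertLetter (n : ℕ) : ℕ → List (List ℕ) → List (List ℕ)
  | a, [] => [[a]]
  | a, [p] :: rest =>
      if a ≤ p then [a] :: insertLetter n p rest else [p, a] :: rest
  | a, [p, q] :: rest =>
      if p ≠ 0 ∧ p ≤ n ∧ q = bar n p ∧ p ≤ a ∧ a ≤ q then
        -- the column is a pair `(x, x̄)` with `x ≠ 0` and `x ≤ a ≤ x̄`
        [p - 1, a] :: insertLetter n (bar n (p - 1)) rest
      else if n + 1 ≤ q ∧ bar n q < p ∧ p < q ∧ a = bar n q ∧ q ≠ n + 1 then
        -- the column is `(β, x̄)` with `x < β < x̄`, `a = x` and `x ≠ n`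
        [a + 1, bar n (a + 1)] :: insertLetter n p rest
      else if a ≤ p then [a, q] :: insertLetter n p rest
      else if a ≤ q then [p, a] :: insertLetter n q rest
      else [p, q, a] :: rest
  | a, C :: rest => (C ++ [a]) :: rest

/-- Column insertion of a word `u = u_1 ⋯ u_j` into a tableau: `u_j` first, `u_1` last. -/
def insertWord (n : ℕ) (u : List ℕ) (T : List (List ℕ)) : List (List ℕ) :=
  u.foldr (fun a T => insertLetter n a T) T

/-- One step of reverse insertion: letter `g` comes back (moving leftward) into a column;
returns the restored column together with the letter passed further left. -/
def revStep (n g : ℕ) (C : List ℕ) : List ℕ × ℕ :=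
  match C with
  | [p] => ([g], p)
  | [p, q] =>
      if p ≠ 0 ∧ p ≤ n ∧ q = bar n p ∧ p ≤ g ∧ g ≤ q then
        ([g, bar n (p - 1)], p - 1)
      else if p ≤ n ∧ g = bar n p ∧ p < q ∧ q < g ∧ p ≠ n then
        ([p + 1, bar n (p + 1)], q)
      else if q ≤ g then ([p, g], q)
      else ([g, q], p)
  | _ => (C, g)

/-- Reverse insertion of a letter through a list of columns, from right to left;
returns the new columns and the letter ejected from the leftmost column. -/
def revPass (n g : ℕ) : List (List ℕ) → List (List ℕ) × ℕ
  | [] => ([], g)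
  | C :: rest =>
      let p := revPass n g rest
      let q := revStep n p.2 C
      (q.1 :: p.1, q.2)

/-- Reverse-bump the rightmost cell of the first row (the last column, a single box). -/
def rbFirst (n : ℕ) (T : List (List ℕ)) : List (List ℕ) × ℕ :=
  match T.getLast? with
  | some [a] => revPass n a T.dropLast
  | _ => (T, 0)

/-- Number of columns of height (at least) two, i.e. the length of the second row. -/
def numTwoCols (T : List (List ℕ)) : ℕ :=
  (T.filter (fun C => decide (2 ≤ C.length))).length

/-- Reverse-bump the rightmost cell of the second row. -/
def rbSecond (n : ℕ) (T : List (List ℕ)) : List (List ℕ) × ℕ :=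
  match (T.drop (numTwoCols T - 1)).head? with
  | some [a, b] =>
      let p := revPass n b (T.take (numTwoCols T - 1))
      (p.1 ++ [a] :: T.drop (numTwoCols T), p.2)
  | _ => (T, 0)

/-- Iterate a reverse-bumping step, collecting the ejected letters in order of ejection. -/
def rbIter (step : List (List ℕ) → List (List ℕ) × ℕ) :
    ℕ → List (List ℕ) → List (List ℕ) × List ℕ
  | 0, T => (T, [])
  | c + 1, T =>
      let p := step T
      let q := rbIter step c p.1
      (q.1, p.2 :: q.2)

/-- A one-row word regarded as a tableau (list of one-box columns). -/
def rowCols (w : List ℕ) : List (List ℕ) := w.map (fun a => [a])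

/-- The row word of a one-row tableau. -/
def colsWord (T : List (List ℕ)) : List ℕ := T.foldr (fun C acc => C ++ acc) []

/-- The word `1^{x_1} ⋯ n^{x_n} n̄^{x̄_n} ⋯ 1̄^{x̄_1}`. -/
def coreWord (n : ℕ) (b : Tup n) : List ℕ :=
  ((List.finRange n).map (fun i => List.replicate (b.1 i) ((i : ℕ) + 1))).foldr (· ++ ·) []
  ++ ((List.finRange n).reverse.map
      (fun i => List.replicate (b.2 i) (bar n ((i : ℕ) + 1)))).foldr (· ++ ·) []

/-- The word `𝕋(b) = 0^{x_0} 1^{x_1} ⋯ 1̄^{x̄_1} 0̄^{x_0}` of an element of the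
`C_n^{(1)}` crystal `B_l`. -/
def rowWordC (n l : ℕ) (b : Tup n) : List ℕ :=
  List.replicate (x0 l b) 0 ++ coreWord n b ++ List.replicate (x0 l b) (bar n 0)

/-- The word `𝕋(b)` with `z` pairs `(0, 0̄)` removed. -/
def hatWordC (n l z : ℕ) (b : Tup n) : List ℕ :=
  List.replicate (x0 l b - z) 0 ++ coreWord n b ++ List.replicate (x0 l b - z) (bar n 0)

/-- The word `𝒯(b) = 1^{x_1} ⋯ 1̄^{x̄_1}` of an element of the `A_{2n-1}^{(2)}` crystal. -/
def rowWordA (n : ℕ) (b : Tup n) : List ℕ := coreWord n b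


set_option linter.unusedVariables false


/-! ### Word crystals -/

def el (n i a : ℕ) : ℕ := if a = i + 1 ∨ a + i = 2 * n + 1 then 1 else 0
def pl (n i a : ℕ) : ℕ := if a = i ∨ a + i = 2 * n then 1 else 0

def we (n i : ℕ) : List ℕ → ℕ
  | [] => 0
  | a :: w => el n i a + (we n i w - pl n i a)

def wp (n i : ℕ) : List ℕ → ℕ
  | [] => 0
  | a :: w => wp n i w + (pl n i a - we n i w)

def wE (n i : ℕ) : List ℕ → List ℕ
  | [] => []
  | a :: w => if we n i w ≤ pl n i a then (a - 1) :: w else a :: wE n i w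

theorem el_le (n i a : ℕ) : el n i a ≤ 1 := by unfold el; split_ifs <;> omega
theorem pl_le (n i a : ℕ) : pl n i a ≤ 1 := by unfold pl; split_ifs <;> omega

theorem pl_of_el {n i a : ℕ} (hi : 1 ≤ i) (hin : i ≤ n) (h : el n i a = 1) : pl n i a = 0 := by
  unfold el at h; unfold pl; split_ifs at * <;> omega
theorem el_pred {n i a : ℕ} (hi : 1 ≤ i) (hin : i ≤ n) (h : el n i a = 1) :
    el n i (a - 1) = 0 ∧ pl n i (a - 1) = 1 ∧ 1 ≤ a := by
  unfold el at *; unfold pl; split_ifs at * <;> omega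

theorem we_app (n i : ℕ) (u v : List ℕ) :
    we n i (u ++ v) = we n i u + (we n i v - wp n i u) ∧
    wp n i (u ++ v) = wp n i v + (wp n i u - we n i v) := by
  induction u with
  | nil => simp [we, wp]
  | cons a u ih =>
    obtain ⟨h1, h2⟩ := ih
    simp only [List.cons_append, we, wp, h1, h2]
    omega

theorem wE_app (n i : ℕ) (u v : List ℕ) (h : 0 < we n i (u ++ v)) :
    wE n i (u ++ v) = if we n i v ≤ wp n i u then wE n i u ++ v else u ++ wE n i v := by
  induction u with
  | nil =>
    have : we n i v ≠ 0 := by simpa using h.ne'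
    simp [wp, this]
  | cons a u ih =>
    have hu := (we_app n i u v).1
    have hh : 0 < el n i a + (we n i (u ++ v) - pl n i a) := h
    have h1 : wE n i (a :: u ++ v) =
      if we n i (u ++ v) ≤ pl n i a then (a - 1) :: (u ++ v) else a :: wE n i (u ++ v) := rfl
    have h2 : wE n i (a :: u) =
      if we n i u ≤ pl n i a then (a - 1) :: u else a :: wE n i u := rfl
    have h3 : wp n i (a :: u) = wp n i u + (pl n i a - we n i u) := rfl
    have ha := el_le n i a
    rw [h1, h2, h3]
    by_cases h0 : 0 < we n i (u ++ v)
    · rw [ih h0]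
      split_ifs <;> first | omega | rfl
    · split_ifs <;> first | omega | rfl

theorem wE_spec {n i : ℕ} (hi : 1 ≤ i) (hin : i ≤ n) (w : List ℕ) (h : 0 < we n i w) :
    we n i (wE n i w) + 1 = we n i w ∧ wp n i (wE n i w) = wp n i w + 1 ∧
    (wE n i w).sum + 1 = w.sum ∧ (wE n i w).length = w.length := by
  induction w with
  | nil => simp [we] at h
  | cons a w ih =>
    simp only [we, wE, wp] at h ⊢
    split_ifs with h1
    · have h2 := el_le n i a
      have h3 : el n i a = 1 := by omega
      have h4 := pl_of_el hi hin h3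
      obtain ⟨h5, h6, h7⟩ := el_pred hi hin h3
      simp only [we, wp, List.sum_cons, List.length_cons, h5, h6, h4, h3]
      refine ⟨by omega, by omega, by omega, trivial⟩
    · obtain ⟨h2, h3, h4, h5⟩ := ih (by omega)
      simp only [we, wp, List.sum_cons, List.length_cons]
      omega

theorem wE_inj {n i : ℕ} (hi : 1 ≤ i) (hin : i ≤ n) (w w' : List ℕ) (h : 0 < we n i w)
    (h' : 0 < we n i w') (hE : wE n i w = wE n i w') : w = w' := by
  induction w generalizing w' with
  | nil => simp [we] at h
  | cons a w ih =>
    cases w' with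
    | nil => simp [we] at h'
    | cons b w' =>
      simp only [we, wE] at h h' hE
      have ha := el_le n i a
      have hb := el_le n i b
      split_ifs at hE with h1 h2 h2
      · obtain ⟨h3, h4⟩ := List.cons.inj hE
        have := (el_pred hi hin (show el n i a = 1 by omega)).2.2
        have := (el_pred hi hin (show el n i b = 1 by omega)).2.2
        rw [h4]; congr 1; omega
      · obtain ⟨h3, h4⟩ := List.cons.inj hE
        have h5 := (el_pred hi hin (show el n i a = 1 by omega))
        have h6 := pl_of_el hi hin (show el n i a = 1 by omega)
        have h7 := (wE_spec hi hin w' (by omega)).1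
        rw [h3] at h5; rw [h4] at h1
        omega
      · obtain ⟨h3, h4⟩ := List.cons.inj hE
        have h5 := (el_pred hi hin (show el n i b = 1 by omega))
        have h6 := pl_of_el hi hin (show el n i b = 1 by omega)
        have h7 := (wE_spec hi hin w (by omega)).1
        rw [← h3] at h5; rw [← h4] at h2
        omega
      · obtain ⟨h3, h4⟩ := List.cons.inj hE
        rw [h3, ih w' (by omega) (by omega) h4]

/-- Crystal equivalence up to depth. -/
def Eqk (n : ℕ) : ℕ → List ℕ → List ℕ → Prop
  | 0, _, _ => True
  | d + 1, w, w' => ∀ i, 1 ≤ i → i ≤ n → we n i w = we n i w' ∧ wp n i w = wp n i w' ∧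
      (0 < we n i w → Eqk n d (wE n i w) (wE n i w'))

def Eqv (n : ℕ) (w w' : List ℕ) : Prop := ∀ d, Eqk n d w w'

theorem Eqv.refl {n : ℕ} (w : List ℕ) : Eqv n w w := by
  intro d
  induction d generalizing w with
  | zero => trivial
  | succ d ih => exact fun i _ _ => ⟨rfl, rfl, fun _ => ih _⟩

theorem Eqv.symm {n : ℕ} {w w' : List ℕ} (h : Eqv n w w') : Eqv n w' w := by
  intro d
  have := h d
  clear h
  induction d generalizing w w' with
  | zero => trivial
  | succ d ih =>
    intro i h1 h2
    obtain ⟨a, b, c⟩ := this i h1 h2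
    exact ⟨a.symm, b.symm, fun h => ih (c (a ▸ h))⟩

theorem Eqv.trans {n : ℕ} {w w' w'' : List ℕ} (h : Eqv n w w') (h' : Eqv n w' w'') :
    Eqv n w w'' := by
  intro d
  have h1 := h d
  have h2 := h' d
  clear h h'
  induction d generalizing w w' w'' with
  | zero => trivial
  | succ d ih =>
    intro i hi hin
    obtain ⟨a, b, c⟩ := h1 i hi hin
    obtain ⟨a', b', c'⟩ := h2 i hi hin
    exact ⟨a.trans a', b.trans b', fun h => ih (c h) (c' (a ▸ h))⟩

theorem Eqk.down {n d : ℕ} {w w' : List ℕ} (h : Eqk n (d + 1) w w') : Eqk n d w w' := by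
  induction d generalizing w w' with
  | zero => trivial
  | succ d ih =>
    intro i hi hin
    obtain ⟨a, b, c⟩ := h i hi hin
    exact ⟨a, b, fun h => ih (c h)⟩

theorem Eqv.app {n : ℕ} {u u' v v' : List ℕ} (h : Eqv n u u') (h' : Eqv n v v') :
    Eqv n (u ++ v) (u' ++ v') := by
  intro d
  have h1 := h d
  have h2 := h' d
  clear h h'
  induction d generalizing u u' v v' with
  | zero => trivial
  | succ d ih =>
    intro i hi hin
    obtain ⟨a, b, c⟩ := h1 i hi hin
    obtain ⟨a', b', c'⟩ := h2 i hi hin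
    have e1 := we_app n i u v
    have e2 := we_app n i u' v'
    refine ⟨by omega, by omega, fun h => ?_⟩
    rw [wE_app n i u v h, wE_app n i u' v' (by omega), ← a', ← b]
    split_ifs
    · exact ih (c (by omega)) h2.down
    · exact ih h1.down (c' (by omega))

theorem Eqv.eps {n i : ℕ} {w w' : List ℕ} (h : Eqv n w w') (hi : 1 ≤ i) (hin : i ≤ n) :
    we n i w = we n i w' := (h 1 i hi hin).1
theorem Eqv.phi {n i : ℕ} {w w' : List ℕ} (h : Eqv n w w') (hi : 1 ≤ i) (hin : i ≤ n) :
    wp n i w = wp n i w' := (h 1 i hi hin).2.1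
theorem Eqv.e {n i : ℕ} {w w' : List ℕ} (h : Eqv n w w') (hi : 1 ≤ i) (hin : i ≤ n)
    (h0 : 0 < we n i w) : Eqv n (wE n i w) (wE n i w') :=
  fun d => (h (d+1) i hi hin).2.2 h0

theorem Eqv.pair {n : ℕ} (hn : 2 ≤ n) (u v : List ℕ) :
    Eqv n (u ++ (1 :: 2 * n :: v)) (u ++ v) := by
  have h : Eqv n [1, 2 * n] [] := by
    intro d
    cases d with
    | zero => trivial
    | succ d =>
      intro i hi hin
      simp only [we, wp, el, pl]
      refine ⟨?_, ?_, ?_⟩ <;> split_ifs <;> omega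
  exact (Eqv.refl u).app (h.app (Eqv.refl v))

theorem Eqv.pairs {n : ℕ} (hn : 2 ≤ n) (z : ℕ) (u v : List ℕ) :
    Eqv n (u ++ (List.replicate z 1 ++ (List.replicate z (2 * n) ++ v))) (u ++ v) := by
  induction z generalizing u v with
  | zero => simpa using Eqv.refl _
  | succ z ih =>
    have : u ++ (List.replicate (z+1) 1 ++ (List.replicate (z+1) (2 * n) ++ v)) =
        (u ++ List.replicate z 1) ++ (1 :: 2 * n :: (List.replicate z (2 * n) ++ v)) := by
      rw [List.replicate_succ', List.replicate_succ]; simp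
    rw [this]
    refine (Eqv.pair hn _ _).trans ?_
    simpa using ih u v

/-! ### Elementary relations -/

/-- `(p q) ⊗ a ≡ b ⊗ (p' q')`. -/
def Ins2 (n a p q p' q' b : ℕ) : Prop :=
  (p + q = 2 * n + 1 ∧ p ≤ a ∧ a ≤ q ∧ p' + 1 = p ∧ q' = a ∧ b = q + 1) ∨
  (a + q = 2 * n + 1 ∧ a < p ∧ p < q ∧ a < n ∧ p' = a + 1 ∧ q' + 1 = q ∧ b = p) ∨
  (a ≤ p ∧ a + q ≠ 2 * n + 1 ∧ p' = a ∧ q' = q ∧ b = p) ∨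
  (p < a ∧ a ≤ q ∧ p + q ≠ 2 * n + 1 ∧ p' = p ∧ q' = a ∧ b = q)

def Col2 (n p q : ℕ) : Prop := 1 ≤ p ∧ p < q ∧ q ≤ 2 * n ∧ ¬ (p = 1 ∧ q = 2 * n)

theorem Ins2.col {n a p q p' q' b : ℕ} (h : Ins2 n a p q p' q' b) (hc : Col2 n p q)
    (ha : 1 ≤ a) : Col2 n p' q' ∧ 1 ≤ b ∧ b ≤ 2 * n ∧ p' ≤ b ∧ a ≤ q' ∧ p' ≤ p ∧ a ≤ q := by
  unfold Ins2 Col2 at *; omega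

theorem let_cases {n i : ℕ} (hi : 1 ≤ i) (hin : i ≤ n) (a : ℕ) :
    (el n i a = 1 ∧ pl n i a = 0 ∧ a = i + 1) ∨ (el n i a = 1 ∧ pl n i a = 0 ∧ a + i = 2 * n + 1) ∨
    (el n i a = 0 ∧ pl n i a = 1 ∧ a = i) ∨ (el n i a = 0 ∧ pl n i a = 1 ∧ a + i = 2 * n) ∨
    (el n i a = 0 ∧ pl n i a = 0 ∧ a ≠ i + 1 ∧ a + i ≠ 2 * n + 1 ∧ a ≠ i ∧ a + i ≠ 2 * n) := by
  unfold el pl; split_ifs <;> omega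

/-- One step of the bisimulation between two three-letter words. -/
def Step3 (n i p q a b p' q' : ℕ) : Prop :=
    we n i [p, q, a] = we n i [b, p', q'] ∧ wp n i [p, q, a] = wp n i [b, p', q'] ∧
    (0 < we n i [p, q, a] → ∃ a1 p1 q1 p1' q1' b1, wE n i [p, q, a] = [p1, q1, a1] ∧
      wE n i [b, p', q'] = [b1, p1', q1'] ∧ Col2 n p1 q1 ∧ 1 ≤ a1 ∧
      Ins2 n a1 p1 q1 p1' q1' b1)

set_option maxHeartbeats 2000000 in
theorem ins2_step1 {n a p q p' q' b i : ℕ} (hn : 2 ≤ n) (hc : Col2 n p q) (ha : 1 ≤ a)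
    (hi : 1 ≤ i) (hin : i ≤ n)
    (h : p + q = 2 * n + 1 ∧ p ≤ a ∧ a ≤ q ∧ p' + 1 = p ∧ q' = a ∧ b = q + 1) :
    Step3 n i p q a b p' q' := by
  obtain ⟨c1, c2, c3, c4⟩ := hc
  obtain ⟨h1, h2, h3, h4, h5, h6⟩ := h
  subst q'
  rcases let_cases hi hin p with H0 | H0 | H0 | H0 | H0 <;> obtain ⟨e0, f0, H0⟩ := H0 <;>
  first
  | omega
  | (rcases let_cases hi hin q with H1 | H1 | H1 | H1 | H1 <;> obtain ⟨e1, f1, H1⟩ := H1 <;>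
     first
     | omega
     | (rcases let_cases hi hin a with H2 | H2 | H2 | H2 | H2 <;> obtain ⟨e2, f2, H2⟩ := H2 <;>
        first
        | omega
        | (rcases let_cases hi hin p' with H3 | H3 | H3 | H3 | H3 <;> obtain ⟨e3, f3, H3⟩ := H3 <;>
           first
           | omega
           | (rcases let_cases hi hin b with H4 | H4 | H4 | H4 | H4 <;> obtain ⟨e4, f4, H4⟩ := H4 <;>
              first
              | omega
              | (simp [Step3, we, wp, wE, e0, f0, e1, f1, e2, f2, e3, f3, e4, f4]
                 try (unfold Col2; and_intros <;> first | omega | (left; and_intros <;> omega) | (right; left; and_intros <;> omega) | (right; right; left; and_intros <;> omega) | (right; right; right; and_intros <;> omega)))))))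

set_option maxHeartbeats 2000000 in
theorem ins2_step2 {n a p q p' q' b i : ℕ} (hn : 2 ≤ n) (hc : Col2 n p q) (ha : 1 ≤ a)
    (hi : 1 ≤ i) (hin : i ≤ n)
    (h : a + q = 2 * n + 1 ∧ a < p ∧ p < q ∧ a < n ∧ p' = a + 1 ∧ q' + 1 = q ∧ b = p) :
    Step3 n i p q a b p' q' := by
  obtain ⟨c1, c2, c3, c4⟩ := hc
  obtain ⟨h1, h2, h3, h4, h5, h6, h7⟩ := h
  subst b
  rcases let_cases hi hin a with H0 | H0 | H0 | H0 | H0 <;> obtain ⟨e0, f0, H0⟩ := H0 <;>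
  first
  | omega
  | (rcases let_cases hi hin q with H1 | H1 | H1 | H1 | H1 <;> obtain ⟨e1, f1, H1⟩ := H1 <;>
     first
     | omega
     | (rcases let_cases hi hin p with H2 | H2 | H2 | H2 | H2 <;> obtain ⟨e2, f2, H2⟩ := H2 <;>
        first
        | omega
        | (rcases let_cases hi hin p' with H3 | H3 | H3 | H3 | H3 <;> obtain ⟨e3, f3, H3⟩ := H3 <;>
           first
           | omega
           | (rcases let_cases hi hin q' with H4 | H4 | H4 | H4 | H4 <;> obtain ⟨e4, f4, H4⟩ := H4 <;>
              first
              | omega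
              | (simp [Step3, we, wp, wE, e0, f0, e1, f1, e2, f2, e3, f3, e4, f4]
                 try (unfold Col2; and_intros <;> first | omega | (left; and_intros <;> omega) | (right; left; and_intros <;> omega) | (right; right; left; and_intros <;> omega) | (right; right; right; and_intros <;> omega)))))))

set_option maxHeartbeats 2000000 in
theorem ins2_step3 {n a p q p' q' b i : ℕ} (hn : 2 ≤ n) (hc : Col2 n p q) (ha : 1 ≤ a)
    (hi : 1 ≤ i) (hin : i ≤ n)
    (h : a ≤ p ∧ a + q ≠ 2 * n + 1 ∧ p' = a ∧ q' = q ∧ b = p) :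
    Step3 n i p q a b p' q' := by
  obtain ⟨c1, c2, c3, c4⟩ := hc
  obtain ⟨h1, h2, h3, h4, h5⟩ := h
  subst p' q' b
  rcases let_cases hi hin p with H0 | H0 | H0 | H0 | H0 <;> obtain ⟨e0, f0, H0⟩ := H0 <;>
  first
  | omega
  | (rcases let_cases hi hin q with H1 | H1 | H1 | H1 | H1 <;> obtain ⟨e1, f1, H1⟩ := H1 <;>
     first
     | omega
     | (rcases let_cases hi hin a with H2 | H2 | H2 | H2 | H2 <;> obtain ⟨e2, f2, H2⟩ := H2 <;>
        first
        | omega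
        | (simp [Step3, we, wp, wE, e0, f0, e1, f1, e2, f2]
           try (unfold Col2; and_intros <;> first | omega | (left; and_intros <;> omega) | (right; left; and_intros <;> omega) | (right; right; left; and_intros <;> omega) | (right; right; right; and_intros <;> omega)))))

set_option maxHeartbeats 2000000 in
theorem ins2_step4 {n a p q p' q' b i : ℕ} (hn : 2 ≤ n) (hc : Col2 n p q) (ha : 1 ≤ a)
    (hi : 1 ≤ i) (hin : i ≤ n)
    (h : p < a ∧ a ≤ q ∧ p + q ≠ 2 * n + 1 ∧ p' = p ∧ q' = a ∧ b = q) :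
    Step3 n i p q a b p' q' := by
  obtain ⟨c1, c2, c3, c4⟩ := hc
  obtain ⟨h1, h2, h3, h4, h5, h6⟩ := h
  subst p' q' b
  rcases let_cases hi hin p with H0 | H0 | H0 | H0 | H0 <;> obtain ⟨e0, f0, H0⟩ := H0 <;>
  first
  | omega
  | (rcases let_cases hi hin q with H1 | H1 | H1 | H1 | H1 <;> obtain ⟨e1, f1, H1⟩ := H1 <;>
     first
     | omega
     | (rcases let_cases hi hin a with H2 | H2 | H2 | H2 | H2 <;> obtain ⟨e2, f2, H2⟩ := H2 <;>
        first
        | omega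
        | (simp [Step3, we, wp, wE, e0, f0, e1, f1, e2, f2]
           try (unfold Col2; and_intros <;> first | omega | (left; and_intros <;> omega) | (right; left; and_intros <;> omega) | (right; right; left; and_intros <;> omega) | (right; right; right; and_intros <;> omega)))))

theorem ins2_step {n a p q p' q' b i : ℕ} (hn : 2 ≤ n) (hc : Col2 n p q) (ha : 1 ≤ a)
    (h : Ins2 n a p q p' q' b) (hi : 1 ≤ i) (hin : i ≤ n) : Step3 n i p q a b p' q' := by
  rcases h with h | h | h | h
  · exact ins2_step1 hn hc ha hi hin h
  · exact ins2_step2 hn hc ha hi hin h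
  · exact ins2_step3 hn hc ha hi hin h
  · exact ins2_step4 hn hc ha hi hin h

theorem Ins2.eqv {n a p q p' q' b : ℕ} (hn : 2 ≤ n) (hc : Col2 n p q) (ha : 1 ≤ a)
    (h : Ins2 n a p q p' q' b) : Eqv n [p, q, a] [b, p', q'] := by
  intro d
  induction d generalizing a p q p' q' b with
  | zero => trivial
  | succ d ih =>
    intro i hi hin
    obtain ⟨h1, h2, h3⟩ := ins2_step hn hc ha h hi hin
    refine ⟨h1, h2, fun h0 => ?_⟩
    obtain ⟨a1, p1, q1, p1', q1', b1, e1, e2, c1, c2, c3⟩ := h3 h0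
    rw [e1, e2]
    exact ih c1 c2 c3

/-! ### Tableaux -/

def col (n : ℕ) : List ℕ → Prop
  | [p] => 1 ≤ p ∧ p ≤ 2 * n
  | [p, q] => Col2 n p q
  | _ => False

def adj (n : ℕ) : List ℕ → List ℕ → Prop
  | [p], [p'] => p ≤ p'
  | [p, _], [p'] => p ≤ p'
  | [p, q], [p', q'] => p ≤ p' ∧ q ≤ q' ∧ ¬ (p = p' ∧ p' + q' = 2 * n + 1) ∧
      ¬ (p + q = 2 * n + 1 ∧ q = q')
  | _, _ => False

def hadj (n : ℕ) (C : List ℕ) : List (List ℕ) → Prop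
  | [] => True
  | D :: _ => adj n C D

def KN (n : ℕ) : List (List ℕ) → Prop
  | [] => True
  | C :: T => col n C ∧ hadj n C T ∧ KN n T

def wd : List (List ℕ) → List ℕ
  | [] => []
  | C :: T => wd T ++ C

theorem col_cases {n : ℕ} {C : List ℕ} (h : col n C) :
    (∃ p, C = [p] ∧ 1 ≤ p ∧ p ≤ 2 * n) ∨ (∃ p q, C = [p, q] ∧ Col2 n p q) := by
  match C, h with
  | [p], h => exact Or.inl ⟨p, rfl, h⟩
  | [p, q], h => exact Or.inr ⟨p, q, rfl, h⟩

theorem wd_app (S T : List (List ℕ)) : wd (S ++ T) = wd T ++ wd S := by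
  induction S with
  | nil => simp [wd]
  | cons C S ih => simp [wd, ih]

/-- Non-terminating insertion step: `C ⊗ a ≡ b ⊗ C'`. -/
def IS (n : ℕ) (C : List ℕ) (a : ℕ) (C' : List ℕ) (b : ℕ) : Prop :=
  (∃ p, C = [p] ∧ C' = [a] ∧ b = p ∧ a ≤ p) ∨
  (∃ p q p' q', C = [p, q] ∧ C' = [p', q'] ∧ Ins2 n a p q p' q' b)

theorem IS.eqv {n : ℕ} (hn : 2 ≤ n) {C C' : List ℕ} {a b : ℕ} (h : IS n C a C' b) (hc : col n C)
    (ha : 1 ≤ a) : Eqv n (C ++ [a]) (b :: C') := by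
  rcases h with ⟨p, rfl, rfl, rfl, h⟩ | ⟨p, q, p', q', rfl, rfl, h⟩
  · exact Eqv.refl _
  · exact h.eqv hn hc ha

theorem IS.col {n : ℕ} {C C' : List ℕ} {a b : ℕ} (h : IS n C a C' b) (hc : col n C)
    (ha : 1 ≤ a) : col n C' ∧ 1 ≤ b ∧ b ≤ 2 * n := by
  rcases h with ⟨p, rfl, rfl, rfl, h⟩ | ⟨p, q, p', q', rfl, rfl, h⟩
  · simp only [KTT.col] at *; omega
  · have := h.col hc ha
    exact ⟨this.1, this.2.1, this.2.2.1⟩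

theorem IS.len {n : ℕ} {C C' : List ℕ} {a b : ℕ} (h : IS n C a C' b) : C'.length = C.length := by
  rcases h with ⟨p, rfl, rfl, rfl, h⟩ | ⟨p, q, p', q', rfl, rfl, h⟩ <;> rfl

/-- insertion into a two-box column -/
theorem ins_two {n a p q : ℕ} (hp : 1 ≤ p) (hpq : p < q) (hq : q ≤ 2 * n) (ha : 1 ≤ a)
    (haq : a ≤ q) (T : List (List ℕ)) :
    ∃ p' q' b, Ins2 n a p q p' q' b ∧
      insertLetter n a ([p, q] :: T) = [p', q'] :: insertLetter n b T := by
  simp only [insertLetter, bar]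
  split_ifs with h1 h2 h3
  · exact ⟨_, _, _, Or.inl ⟨by omega, by omega, by omega, by omega, rfl, by omega⟩, rfl⟩
  · exact ⟨_, _, _, Or.inr (Or.inl ⟨by omega, by omega, by omega, by omega, rfl, by omega, rfl⟩), rfl⟩
  · exact ⟨_, _, _, Or.inr (Or.inr (Or.inl ⟨by omega, by omega, rfl, rfl, rfl⟩)), rfl⟩
  · exact ⟨_, _, _, Or.inr (Or.inr (Or.inr ⟨by omega, by omega, by omega, rfl, rfl, rfl⟩)), rfl⟩

theorem ins_three {n a p q : ℕ} (hp : 1 ≤ p) (hpq : p < q) (hq : q ≤ 2 * n) (ha : 1 ≤ a)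
    (haq : q < a) (T : List (List ℕ)) :
      insertLetter n a ([p, q] :: T) = [p, q, a] :: T := by
  simp only [insertLetter]
  rw [if_neg (by omega), if_neg (by unfold bar; omega), if_neg (by omega), if_neg (by omega)]

theorem ins_one {n a p : ℕ} (T : List (List ℕ)) :
      insertLetter n a ([p] :: T) =
        if a ≤ p then [a] :: insertLetter n p T else [p, a] :: T := by
  simp only [insertLetter]

/-- no column of height three is created -/
def NB (n a : ℕ) (T : List (List ℕ)) : Prop := ∀ C ∈ insertLetter n a T, C.length ≤ 2

theorem NB_single {n : ℕ} {T : List (List ℕ)} {p : ℕ} (h : KN n ([p] :: T)) (b : ℕ) : NB n b T := by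
  induction T generalizing p b with
  | nil => intro C hC; simp [insertLetter] at hC; simp [hC]
  | cons D T ih =>
    obtain ⟨h1, h2, h3⟩ := h
    rcases col_cases h3.1 with ⟨r, rfl, hr⟩ | ⟨r, s, rfl, hr⟩
    · intro C hC
      rw [ins_one] at hC
      split_ifs at hC
      · rcases List.mem_cons.1 hC with rfl | hC
        · simp
        · exact ih h3 _ C hC
      · rcases List.mem_cons.1 hC with rfl | hC
        · simp
        · have : ∀ (T : List (List ℕ)) r, KN n ([r] :: T) → ∀ C ∈ T, C.length ≤ 2 := by
            intro T
            induction T with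
            | nil => simp
            | cons D T ih =>
              intro r h C hC
              rcases col_cases h.2.2.1 with ⟨t, rfl, ht⟩ | ⟨t, s, rfl, ht⟩
              · rcases List.mem_cons.1 hC with rfl | hC
                · simp
                · exact ih t h.2.2 C hC
              · exact absurd h.2.1 (by simp [hadj, adj])
          exact this T r h3 C hC
    · exact absurd h2 (by simp [hadj, adj])

theorem ins2_mono {n a a' p q p' q' b p'' q'' b' : ℕ} (hc : Col2 n p q) (ha : 1 ≤ a')
    (haa : a' ≤ a) (h : Ins2 n a p q p' q' b) (h' : Ins2 n a' p' q' p'' q'' b') : b' ≤ b := by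
  unfold Ins2 Col2 at *
  omega

theorem NB_next {n : ℕ} {T : List (List ℕ)} {a a' : ℕ} (h : KN n T) (ha : 1 ≤ a') (ha' : a' ≤ a)
    (hb : NB n a T) (ha2 : a ≤ 2 * n) : NB n a' (insertLetter n a T) := by
  induction T generalizing a a' with
  | nil =>
    intro C hC
    simp only [insertLetter, ha', if_true, List.mem_cons, List.not_mem_nil, or_false] at hC
    rcases hC with rfl | rfl <;> simp
  | cons D T ih =>
    rcases col_cases h.1 with ⟨p, rfl, hp⟩ | ⟨p, q, rfl, hpq⟩
    · unfold NB at hb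
      rw [ins_one] at hb ⊢
      split_ifs at * with h1
      · intro C hC
        rw [ins_one, if_pos ha'] at hC
        rcases List.mem_cons.1 hC with rfl | hC
        · simp
        · exact ih h.2.2 (by omega) h1 (fun C hC => hb C (List.mem_cons_of_mem _ hC)) hp.2 C hC
      · obtain ⟨p', q', b, _, h4⟩ := ins_two (n := n) hp.1 (not_le.1 h1) ha2 ha ha' T
        intro C hC
        rw [h4] at hC
        rcases List.mem_cons.1 hC with rfl | hC
        · simp
        · exact NB_single h _ C hC
    · obtain ⟨c1, c2, c3, c4⟩ := id hpq
      by_cases haq : a ≤ q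
      · obtain ⟨p', q', b, h3, h4⟩ := ins_two (n := n) c1 c2 c3 (by omega) haq T
        unfold NB at hb
        rw [h4] at hb ⊢
        obtain ⟨⟨d1, d2, d3, d4⟩, k1, k2, k3, k4, k5, k6⟩ := h3.col hpq (by omega)
        obtain ⟨p'', q'', b', h5, h6⟩ := ins_two (n := n) d1 d2 d3 ha (by omega) (insertLetter n b T)
        intro C hC
        rw [h6] at hC
        rcases List.mem_cons.1 hC with rfl | hC
        · simp
        · have := ins2_mono hpq ha ha' h3 h5
          have hb' := h5.col ⟨d1, d2, d3, d4⟩ ha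
          exact ih h.2.2 (by omega) this (fun C hC => hb C (List.mem_cons_of_mem _ hC)) k2 C hC
      · exfalso
        unfold NB at hb
        rw [ins_three c1 c2 c3 (by omega) (by omega)] at hb
        have := hb [p, q, a] (by simp)
        simp at this

theorem fwd_pair {n a p q p' q' b r s r' s' c : ℕ} (hc : Col2 n p q) (hd : Col2 n r s) (ha : 1 ≤ a)
    (h : Ins2 n a p q p' q' b) (h' : Ins2 n b r s r' s' c) (hA : adj n [p, q] [r, s]) :
    adj n [p', q'] [r', s'] := by
  obtain ⟨A1, A2, A3, A4⟩ := hA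
  obtain ⟨c1, c2, c3, c4⟩ := hc
  obtain ⟨d1, d2, d3, d4⟩ := hd
  simp only [adj]
  rcases h with h | h | h | h <;> rcases h' with h' | h' | h' | h' <;>
    refine ⟨?_, ?_, ?_, ?_⟩ <;> omega

theorem rev_pair {n a p q p' q' b r s r' s' c : ℕ} (hc : Col2 n p q) (hd : Col2 n r s) (ha : 1 ≤ a)
    (hc' : Col2 n p' q') (hd' : Col2 n r' s')
    (h : Ins2 n a p q p' q' b) (h' : Ins2 n b r s r' s' c) (hA : adj n [p', q'] [r', s']) :
    adj n [p, q] [r, s] := by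
  obtain ⟨A1, A2, A3, A4⟩ := hA
  obtain ⟨c1, c2, c3, c4⟩ := hc
  obtain ⟨d1, d2, d3, d4⟩ := hd
  obtain ⟨c1', c2', c3', c4'⟩ := hc'
  obtain ⟨d1', d2', d3', d4'⟩ := hd'
  simp only [adj]
  rcases h with h | h | h | h <;> rcases h' with h' | h' | h' | h' <;>
    refine ⟨?_, ?_, ?_, ?_⟩ <;> omega

theorem n2_one (p : ℕ) (T : List (List ℕ)) : numTwoCols ([p] :: T) = numTwoCols T := by
  simp [numTwoCols]
theorem n2_two (p q : ℕ) (T : List (List ℕ)) :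
    numTwoCols ([p, q] :: T) = numTwoCols T + 1 := by
  simp [numTwoCols]
theorem n2_nil : numTwoCols [] = 0 := by simp [numTwoCols]

theorem ins_spec {n : ℕ} (hn : 2 ≤ n) {T : List (List ℕ)} {a : ℕ} (h : KN n T) (ha : 1 ≤ a)
    (ha2 : a ≤ 2 * n) (hb : NB n a T) (hh : ∀ T', T = [1] :: T' → a ≠ 2 * n) :
    KN n (insertLetter n a T) ∧ Eqv n (wd T ++ [a]) (wd (insertLetter n a T)) ∧
    numTwoCols (insertLetter n a T) ≤ numTwoCols T + 1 ∧
    (insertLetter n a T).length + numTwoCols (insertLetter n a T) =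
      T.length + numTwoCols T + 1 := by
  induction T generalizing a with
  | nil =>
    simp only [insertLetter, KN, wd, n2_one, n2_nil, hadj, col]
    exact ⟨⟨⟨ha, ha2⟩, trivial, trivial⟩, Eqv.refl _, by omega, by simp⟩
  | cons C T ih =>
    rcases col_cases h.1 with ⟨p, rfl, hp⟩ | ⟨p, q, rfl, hpq⟩
    · rw [ins_one]
      unfold NB at hb
      rw [ins_one] at hb
      split_ifs at hb ⊢ with h1
      · obtain ⟨i1, i2, i3, i4⟩ := ih h.2.2 hp.1 hp.2
          (fun C hC => hb C (List.mem_cons_of_mem _ hC)) (by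
            rintro T' rfl
            have := h.2.1
            simp only [hadj, adj] at this
            omega)
        refine ⟨⟨⟨ha, ha2⟩, ?_, i1⟩, ?_, ?_, ?_⟩
        · cases T with
          | nil => simpa [insertLetter, hadj, adj] using h1
          | cons D T =>
            have h2 := h.2.1
            rcases col_cases h.2.2.1 with ⟨r, rfl, hr⟩ | ⟨r, s, rfl, hr⟩
            · simp only [hadj, adj] at h2
              rw [ins_one, if_pos h2]
              simpa [hadj, adj] using h1
            · simp [hadj, adj] at h2
        · simp only [wd]
          exact i2.app (Eqv.refl [a])
        · simp only [n2_one]; exact i3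
        · simp only [n2_one, List.length_cons]; omega
      · refine ⟨⟨⟨hp.1, by omega, ha2, ?_⟩, ?_, h.2.2⟩, ?_, ?_, ?_⟩
        · rintro ⟨rfl, rfl⟩
          exact hh T rfl rfl
        · cases T with
          | nil => trivial
          | cons D T =>
            have h2 := h.2.1
            rcases col_cases h.2.2.1 with ⟨r, rfl, hr⟩ | ⟨r, s, rfl, hr⟩
            · exact h2
            · simp [hadj, adj] at h2
        · simp only [wd, List.append_assoc]
          exact Eqv.refl _
        · simp only [n2_one, n2_two]; omega
        · simp only [n2_one, n2_two, List.length_cons]; omega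
    · obtain ⟨c1, c2, c3, c4⟩ := id hpq
      by_cases haq : a ≤ q
      · obtain ⟨p', q', b, h3, h4⟩ := ins_two (n := n) c1 c2 c3 (by omega) haq T
        unfold NB at hb
        rw [h4] at hb ⊢
        obtain ⟨hcol, k1, k2, k3, k4, k5, k6⟩ := h3.col hpq (by omega)
        have hb' : NB n b T := fun C hC => hb C (List.mem_cons_of_mem _ hC)
        obtain ⟨i1, i2, i3, i4⟩ := ih h.2.2 k1 k2 hb' (by
            rintro T' rfl
            have := h.2.1
            simp only [hadj, adj] at this
            unfold Ins2 at h3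
            omega)
        refine ⟨⟨hcol, ?_, i1⟩, ?_, ?_, ?_⟩
        · cases T with
          | nil => simpa [insertLetter, hadj, adj] using k3
          | cons D T =>
            have h2 := h.2.1
            rcases col_cases h.2.2.1 with ⟨r, rfl, hr⟩ | ⟨r, s, rfl, hr⟩
            · simp only [hadj, adj] at h2
              rw [ins_one]
              split_ifs with h5
              · simpa [hadj, adj] using k3
              · simp only [hadj, adj]
                rcases h3 with h3 | h3 | h3 | h3 <;> refine ⟨?_, ?_, ?_, ?_⟩ <;> omega
            · obtain ⟨d1, d2, d3, d4⟩ := id hr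
              have : b ≤ s := by
                by_contra hc
                unfold NB at hb'
                rw [ins_three d1 d2 d3 k1 (by omega)] at hb'
                have := hb' [r, s, b] (by simp)
                simp at this
              obtain ⟨r', s', c, h5, h6⟩ := ins_two (n := n) d1 d2 d3 k1 this T
              rw [h6]
              exact fwd_pair hpq hr ha h3 h5 h2
        · simp only [wd]
          rw [List.append_assoc]
          refine ((Eqv.refl (wd T)).app (h3.eqv hn hpq ha)).trans ?_
          have := i2.app (Eqv.refl (n := n) [p', q'])
          simpa using this
        · simp only [n2_two]; omega
        · simp only [n2_two, List.length_cons]; omega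
      · exfalso
        unfold NB at hb
        rw [ins_three c1 c2 c3 (by omega) (by omega)] at hb
        have := hb [p, q, a] (by simp)
        simp at this

theorem ins_head {n : ℕ} (hn : 2 ≤ n) {T : List (List ℕ)} (h : KN n T) (T' : List (List ℕ)) :
    insertLetter n (2 * n) T ≠ [1] :: T' := by
  cases T with
  | nil => simp [insertLetter]
  | cons C T =>
    rcases col_cases h.1 with ⟨p, rfl, hp⟩ | ⟨p, q, rfl, hpq⟩
    · rw [ins_one]
      split_ifs with h1
      · intro h; simp at h
      · simp
    · obtain ⟨c1, c2, c3, c4⟩ := id hpq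
      by_cases haq : 2 * n ≤ q
      · obtain ⟨p', q', b, h3, h4⟩ := ins_two (n := n) c1 c2 c3 (by omega) haq T
        rw [h4]; simp
      · rw [ins_three c1 c2 c3 (by omega) (by omega)]; simp

theorem insW_spec {n : ℕ} (hn : 2 ≤ n) {T : List (List ℕ)} (h : KN n T)
    (hs : ∀ a, NB n a T) (u : List ℕ) (hu : u.Pairwise (· ≤ ·))
    (hur : ∀ x ∈ u, 1 ≤ x ∧ x ≤ 2 * n) (hh : ∀ T', T = [1] :: T' → 2 * n ∉ u) :
    (KN n (insertWord n u T) ∧ Eqv n (wd T ++ u.reverse) (wd (insertWord n u T)) ∧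
    numTwoCols (insertWord n u T) ≤ numTwoCols T + u.length ∧
    (insertWord n u T).length + numTwoCols (insertWord n u T) =
      T.length + numTwoCols T + u.length) ∧
    ∀ a, 1 ≤ a → a ≤ 2 * n → (∀ x ∈ u, a ≤ x) → NB n a (insertWord n u T) ∧
      ((∀ T', T = [1] :: T' → a ≠ 2 * n) → ∀ T', insertWord n u T = [1] :: T' → a ≠ 2 * n) := by
  induction u with
  | nil =>
    refine ⟨⟨h, by simpa [insertWord] using Eqv.refl _, by simp [insertWord], by simp [insertWord]⟩, ?_⟩
    intro a _ _ _
    exact ⟨hs a, fun h => h⟩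
  | cons x u ih =>
    obtain ⟨⟨i1, i2, i3, i4⟩, i5⟩ := ih (List.pairwise_cons.1 hu).2
      (fun y hy => hur y (List.mem_cons_of_mem _ hy))
      (fun T' h1 h2 => hh T' h1 (List.mem_cons_of_mem _ h2))
    obtain ⟨hx1, hx2⟩ := hur x (by simp)
    obtain ⟨i6, i7⟩ := i5 x hx1 hx2 (List.pairwise_cons.1 hu).1
    have e : insertWord n (x :: u) T = insertLetter n x (insertWord n u T) := rfl
    have i8 := i7 (fun T' h1 h2 => hh T' h1 (by simp [h2]))
    obtain ⟨j1, j2, j3, j4⟩ := ins_spec hn i1 hx1 hx2 i6 i8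
    rw [e]
    refine ⟨⟨j1, ?_, ?_, ?_⟩, ?_⟩
    · have := i2.app (Eqv.refl (n := n) [x])
      have := this.trans j2
      simpa using this
    · simp only [List.length_cons]; omega
    · simp only [List.length_cons]; omega
    · intro a ha ha2 hax
      refine ⟨NB_next i1 ha (hax x (by simp)) i6 hx2, ?_⟩
      rintro - T' hT rfl
      have : x = 2 * n := by have := hax x (by simp); omega
      subst this
      exact ins_head hn i1 T' hT

theorem row_KN {n : ℕ} (w : List ℕ) (hw : w.Pairwise (· ≤ ·)) (hr : ∀ x ∈ w, 1 ≤ x ∧ x ≤ 2 * n) :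
    KN n (rowCols w) := by
  induction w with
  | nil => trivial
  | cons a w ih =>
    refine ⟨hr a (by simp), ?_, ih (List.pairwise_cons.1 hw).2
      (fun y hy => hr y (List.mem_cons_of_mem _ hy))⟩
    cases w with
    | nil => trivial
    | cons b w => exact (List.pairwise_cons.1 hw).1 b (by simp)

theorem row_NB {n : ℕ} (w : List ℕ) (hw : KN n (rowCols w)) (a : ℕ) : NB n a (rowCols w) := by
  cases w with
  | nil => intro C hC; simp [rowCols, insertLetter] at hC; simp [hC]
  | cons b w =>
    refine NB_single (p := b) (T := rowCols (b :: w)) ⟨hw.1, ?_, hw⟩ a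
    simp [rowCols, hadj, adj]

theorem row_wd (w : List ℕ) : wd (rowCols w) = w.reverse := by
  induction w with
  | nil => rfl
  | cons b w ih =>
    have : rowCols (b :: w) = [b] :: rowCols w := rfl
    rw [this]; simp [wd, ih]

theorem row_n2 (w : List ℕ) : numTwoCols (rowCols w) = 0 := by
  induction w with
  | nil => rfl
  | cons b w ih =>
    have : rowCols (b :: w) = [b] :: rowCols w := rfl
    rw [this, n2_one, ih]

theorem fwd_main {n : ℕ} (hn : 2 ≤ n) (w u : List ℕ) (hw : w.Pairwise (· ≤ ·))
    (hwr : ∀ x ∈ w, 1 ≤ x ∧ x ≤ 2 * n) (hu : u.Pairwise (· ≤ ·))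
    (hur : ∀ x ∈ u, 1 ≤ x ∧ x ≤ 2 * n) (hh : 1 ∈ w → 2 * n ∉ u) :
    KN n (insertWord n u (rowCols w)) ∧
    Eqv n (w.reverse ++ u.reverse) (wd (insertWord n u (rowCols w))) ∧
    numTwoCols (insertWord n u (rowCols w)) ≤ u.length ∧
    (insertWord n u (rowCols w)).length + numTwoCols (insertWord n u (rowCols w)) =
      w.length + u.length := by
  have hK := row_KN w hw hwr
  obtain ⟨⟨h1, h2, h3, h4⟩, -⟩ := insW_spec hn hK (row_NB w hK) u hu hur (by
    intro T' hT
    apply hh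
    cases w with
    | nil => simp [rowCols] at hT
    | cons b w => simp [rowCols] at hT; simp [hT])
  rw [row_wd] at h2
  rw [row_n2] at h3 h4
  refine ⟨h1, h2, by omega, ?_⟩
  rw [h4]; simp [rowCols]

theorem rev_step {n g : ℕ} {C' : List ℕ} (hc : col n C') (ht : C'.headI ≤ g) (hg : g ≤ 2 * n) :
    ∃ C a, revStep n g C' = (C, a) ∧ IS n C a C' g ∧ col n C ∧ 1 ≤ a ∧ a ≤ 2 * n := by
  rcases col_cases hc with ⟨p, rfl, hp⟩ | ⟨p, q, rfl, hpq⟩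
  · simp only [List.headI] at ht
    exact ⟨[g], p, rfl, Or.inl ⟨g, rfl, rfl, rfl, ht⟩, ⟨by omega, hg⟩, hp.1, hp.2⟩
  · obtain ⟨c1, c2, c3, c4⟩ := id hpq
    simp only [List.headI] at ht
    simp only [revStep]
    split_ifs with h1 h2 h3
    · unfold bar at h1
      refine ⟨_, _, rfl, Or.inr ⟨_, _, _, _, rfl, rfl, Or.inr (Or.inl ?_)⟩, ?_, ?_⟩ <;>
        (try simp only [bar, col, Col2]) <;> first | omega | (and_intros <;> first | omega | trivial)
    · unfold bar at h2
      refine ⟨_, _, rfl, Or.inr ⟨_, _, _, _, rfl, rfl, Or.inl ?_⟩, ?_, ?_⟩ <;>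
        (try simp only [bar, col, Col2]) <;> first | omega | (and_intros <;> first | omega | trivial)
    · unfold bar at h1 h2
      refine ⟨_, _, rfl, Or.inr ⟨_, _, _, _, rfl, rfl, Or.inr (Or.inr (Or.inr ?_))⟩, ?_, ?_⟩ <;>
        (try simp only [bar, col, Col2]) <;> first | omega | (and_intros <;> first | omega | trivial)
    · unfold bar at h1 h2
      refine ⟨_, _, rfl, Or.inr ⟨_, _, _, _, rfl, rfl, Or.inr (Or.inr (Or.inl ?_))⟩, ?_, ?_⟩ <;>
        (try simp only [bar, col, Col2]) <;> first | omega | (and_intros <;> first | omega | trivial)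

theorem rev_top {n b c : ℕ} {C' D D' : List ℕ} (hc : col n C') (hA : adj n C' D')
    (h : IS n D b D' c) : C'.headI ≤ b := by
  rcases col_cases hc with ⟨p, rfl, hp⟩ | ⟨p, q, rfl, hpq⟩
  · rcases h with ⟨r, rfl, rfl, rfl, h⟩ | ⟨r, s, r', s', rfl, rfl, h⟩
    · exact hA
    · simp [adj] at hA
  · rcases h with ⟨r, rfl, rfl, rfl, h⟩ | ⟨r, s, r', s', rfl, rfl, h⟩
    · exact hA
    · simp only [adj, Col2, List.headI] at *
      rcases h with h | h | h | h <;> omega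

theorem rev_adj {n a b c : ℕ} {C C' D D' : List ℕ} (hc' : col n C') (hd' : col n D')
    (hc : col n C) (hd : col n D) (ha : 1 ≤ a) (hA : adj n C' D')
    (h : IS n C a C' b) (h' : IS n D b D' c) : adj n C D := by
  rcases h with ⟨r, rfl, rfl, rfl, h⟩ | ⟨r, s, r', s', rfl, rfl, h⟩
  · rcases h' with ⟨p, rfl, rfl, rfl, h'⟩ | ⟨p, q, p', q', rfl, rfl, h'⟩
    · exact h'
    · simp [adj] at hA
  · rcases h' with ⟨p, rfl, rfl, rfl, h'⟩ | ⟨p, q, p', q', rfl, rfl, h'⟩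
    · simp only [adj, col, Col2] at *
      rcases h with h | h | h | h <;> omega
    · exact rev_pair hc hd ha hc' hd' h h' hA

def Trn (n : ℕ) (S S' : List (List ℕ)) (g : ℕ) : Prop :=
  KN n S' ∧ 1 ≤ g ∧ g ≤ 2 * n ∧ (∀ C', col n C' → hadj n C' S → C'.headI ≤ g) ∧
  (∀ C a C', col n C → col n C' → 1 ≤ a → hadj n C' S → IS n C a C' g → hadj n C S')

theorem rev_pass {n g : ℕ} (hn : 2 ≤ n) {S S' : List (List ℕ)} (hS : Trn n S S' g)
    (T : List (List ℕ)) (hK : KN n (T ++ S)) :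
    ∃ T' c, revPass n g T = (T', c) ∧ Trn n (T ++ S) (T' ++ S') c ∧ T'.length = T.length ∧
      numTwoCols T' = numTwoCols T ∧ Eqv n (g :: wd T) (wd T' ++ [c]) := by
  induction T with
  | nil => exact ⟨[], g, rfl, hS, rfl, rfl, Eqv.refl _⟩
  | cons C' T ih =>
    obtain ⟨h1, h2, h3⟩ := hK
    obtain ⟨T', c, i1, i2, i3, i4, i5⟩ := ih h3
    obtain ⟨k1, k2, k3, k4, k5⟩ := i2
    obtain ⟨C, a, j1, j2, j3, j4, j5⟩ := rev_step h1 (k4 C' h1 h2) k3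
    refine ⟨C :: T', a, ?_, ⟨⟨j3, ?_, k1⟩, j4, j5, ?_, ?_⟩, ?_, ?_, ?_⟩
    · simp only [revPass, i1, j1]
    · exact k5 C a C' j3 h1 j4 h2 j2
    · intro D' hD' hA
      exact rev_top hD' hA j2
    · intro D x D' hD hD' hx hA hI
      exact rev_adj hD' h1 hD j3 hx hA hI j2
    · simp [i3]
    · rcases j2 with ⟨r, rfl, rfl, rfl, h⟩ | ⟨r, s, r', s', rfl, rfl, h⟩
      · simp only [n2_one, i4]
      · simp only [n2_two, i4]
    · have e1 := i5.app (Eqv.refl (n := n) C')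
      have e2 := (Eqv.refl (n := n) (wd T')).app (j2.eqv hn j3 j4).symm
      have e3 : Eqv n (wd T' ++ [c] ++ C') (wd T' ++ (C ++ [a])) := by simpa using e2
      simpa [wd] using e1.trans e3

theorem KN_left {n : ℕ} {T S : List (List ℕ)} (h : KN n (T ++ S)) : KN n S := by
  induction T with
  | nil => exact h
  | cons C T ih => exact ih h.2.2

theorem n2_app (T S : List (List ℕ)) : numTwoCols (T ++ S) = numTwoCols T + numTwoCols S := by
  simp [numTwoCols]

theorem n2_sgl {n p : ℕ} {T : List (List ℕ)} (h : KN n ([p] :: T)) : numTwoCols T = 0 := by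
  induction T generalizing p with
  | nil => rfl
  | cons D T ih =>
    rcases col_cases h.2.2.1 with ⟨r, rfl, hr⟩ | ⟨r, s, rfl, hr⟩
    · rw [n2_one]; exact ih h.2.2
    · exact absurd h.2.1 (by simp [hadj, adj])

theorem n2_dbl {n a b : ℕ} {T S : List (List ℕ)} (h : KN n (T ++ [a, b] :: S)) :
    numTwoCols T = T.length := by
  induction T with
  | nil => rfl
  | cons D T ih =>
    rcases col_cases h.1 with ⟨r, rfl, hr⟩ | ⟨r, s, rfl, hr⟩
    · have : numTwoCols (T ++ [a, b] :: S) = 0 := n2_sgl (n := n) h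
      rw [n2_app, n2_two] at this
      omega
    · rw [n2_two, ih h.2.2]; rfl

theorem shape_last {n : ℕ} {T : List (List ℕ)} (h : KN n T) (hl : numTwoCols T < T.length) :
    ∃ T1 g, T = T1 ++ [[g]] := by
  rcases List.eq_nil_or_concat T with rfl | ⟨T1, x, rfl⟩
  · simp at hl
  · have h' := h
    rw [List.concat_eq_append] at h'
    rcases col_cases (KN_left h').1 with ⟨r, rfl, hr⟩ | ⟨r, s, rfl, hr⟩
    · exact ⟨T1, r, by simp⟩
    · have := n2_dbl h'
      rw [List.concat_eq_append, n2_app, n2_two, n2_nil] at hl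
      simp at hl
      omega

theorem shape_second {n c : ℕ} {T : List (List ℕ)} (h : KN n T) (hl : numTwoCols T = c + 1) :
    ∃ T1 a b T2, T = T1 ++ [a, b] :: T2 ∧ T1.length = c ∧ numTwoCols T2 = 0 := by
  induction T generalizing c with
  | nil => simp [numTwoCols] at hl
  | cons D T ih =>
    rcases col_cases h.1 with ⟨r, rfl, hr⟩ | ⟨r, s, rfl, hr⟩
    · have := n2_sgl h
      rw [n2_one] at hl; omega
    · rw [n2_two] at hl
      cases c with
      | zero => exact ⟨[], r, s, T, rfl, rfl, by omega⟩
      | succ c =>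
        obtain ⟨T1, a, b, T2, rfl, h2, h3⟩ := ih (c := c) h.2.2 (by omega)
        exact ⟨[r, s] :: T1, a, b, T2, rfl, by simp [h2], h3⟩

theorem rbFirst_spec {n : ℕ} (hn : 2 ≤ n) {T : List (List ℕ)} (h : KN n T)
    (hl : numTwoCols T < T.length) :
    ∃ T' c, rbFirst n T = (T', c) ∧ KN n T' ∧ numTwoCols T' = numTwoCols T ∧
      T'.length + 1 = T.length ∧ Eqv n (wd T) (wd T' ++ [c]) := by
  obtain ⟨T1, g, rfl⟩ := shape_last h hl
  have hg := (KN_left h).1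
  obtain ⟨T', c, i1, i2, i3, i4, i5⟩ := rev_pass (g := g) (S := [[g]]) (S' := []) hn
    ⟨trivial, hg.1, hg.2, by
      intro C' hC hA
      rcases col_cases hC with ⟨r, rfl, hr⟩ | ⟨r, s, rfl, hr⟩ <;> exact hA,
      fun _ _ _ _ _ _ _ _ => trivial⟩ T1 h
  refine ⟨T', c, ?_, ?_, ?_, ?_, ?_⟩
  · simp [rbFirst, i1]
  · simpa using i2.1
  · simp [n2_app, i4, n2_one, n2_nil]
  · simp [i3]
  · rw [wd_app]; simpa [wd] using i5

theorem rbSecond_spec {n : ℕ} (hn : 2 ≤ n) {T : List (List ℕ)} (h : KN n T)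
    (hl : 0 < numTwoCols T) :
    ∃ T' c, rbSecond n T = (T', c) ∧ KN n T' ∧ numTwoCols T' + 1 = numTwoCols T ∧
      T'.length = T.length ∧ Eqv n (wd T) (wd T' ++ [c]) := by
  obtain ⟨T1, a, b, T2, rfl, h1, h2⟩ := shape_second (c := numTwoCols T - 1) h (by omega)
  obtain ⟨hc, ha, hK⟩ := KN_left h
  have hd := n2_dbl h
  have hN : numTwoCols (T1 ++ [a, b] :: T2) = T1.length + 1 := by
    rw [n2_app, n2_two]; omega
  obtain ⟨c1, c2, c3, c4⟩ := id hc
  obtain ⟨T', c, i1, i2, i3, i4, i5⟩ := rev_pass (g := b) (S := [a, b] :: T2) (S' := [a] :: T2) hn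
    ⟨⟨⟨by omega, by omega⟩, by
      cases T2 with
      | nil => trivial
      | cons D T2 =>
        rcases col_cases hK.1 with ⟨r, rfl, hr⟩ | ⟨r, s, rfl, hr⟩
        · exact ha
        · simp [n2_two] at h2, hK⟩, by omega, by omega, by
      intro C' hC hA
      rcases col_cases hC with ⟨r, rfl, hr⟩ | ⟨r, s, rfl, hr⟩
      · simp [hadj, adj] at hA
      · simp only [hadj, adj, List.headI] at *
        omega, by
      rintro C x C' hC hC' hx hA (⟨r, rfl, rfl, rfl, hI⟩ | ⟨r, s, r', s', rfl, rfl, hI⟩)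
      · simp [hadj, adj] at hA
      · simp only [hadj, adj, col, Col2] at *
        rcases hI with h | h | h | h <;> omega⟩ T1 h
  refine ⟨T' ++ [a] :: T2, c, ?_, i2.1, ?_, ?_, ?_⟩
  · unfold rbSecond
    rw [hN]
    have e1 : (T1 ++ [a, b] :: T2).drop (T1.length + 1 - 1) = [a, b] :: T2 := by simp
    have e2 : (T1 ++ [a, b] :: T2).take (T1.length + 1 - 1) = T1 := by simp
    have e3 : (T1 ++ [a, b] :: T2).drop (T1.length + 1) = T2 := by
      rw [List.drop_append]; simp
    rw [e1, e2, e3]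
    simp [i1]
  · rw [hN, n2_app, n2_one]; omega
  · simp [i3]
  · have e1 := (Eqv.refl (n := n) (wd T2 ++ [a])).app i5
    rw [wd_app, wd_app]; simpa [wd] using e1

theorem rbIter1 {n : ℕ} (hn : 2 ≤ n) (c : ℕ) (T : List (List ℕ)) (h : KN n T)
    (hl : c + numTwoCols T ≤ T.length) :
    KN n (rbIter (rbFirst n) c T).1 ∧ numTwoCols (rbIter (rbFirst n) c T).1 = numTwoCols T ∧
    (rbIter (rbFirst n) c T).1.length + c = T.length ∧
    Eqv n (wd T) (wd (rbIter (rbFirst n) c T).1 ++ (rbIter (rbFirst n) c T).2.reverse) := by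
  induction c generalizing T with
  | zero => exact ⟨h, rfl, rfl, by simpa [rbIter] using Eqv.refl _⟩
  | succ c ih =>
    obtain ⟨T', x, h1, h2, h3, h4, h5⟩ := rbFirst_spec hn h (by omega)
    obtain ⟨i1, i2, i3, i4⟩ := ih T' h2 (by omega)
    simp only [rbIter, h1]
    refine ⟨i1, by omega, by omega, h5.trans ?_⟩
    simpa using i4.app (Eqv.refl (n := n) [x])

theorem rbIter2 {n : ℕ} (hn : 2 ≤ n) (c : ℕ) (T : List (List ℕ)) (h : KN n T)
    (hl : c = numTwoCols T) :
    KN n (rbIter (rbSecond n) c T).1 ∧ numTwoCols (rbIter (rbSecond n) c T).1 = 0 ∧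
    Eqv n (wd T) (wd (rbIter (rbSecond n) c T).1 ++ (rbIter (rbSecond n) c T).2.reverse) := by
  induction c generalizing T with
  | zero => exact ⟨h, hl.symm, by simpa [rbIter] using Eqv.refl _⟩
  | succ c ih =>
    obtain ⟨T', x, h1, h2, h3, h4, h5⟩ := rbSecond_spec hn h (by omega)
    obtain ⟨i1, i2, i4⟩ := ih T' h2 (by omega)
    simp only [rbIter, h1]
    refine ⟨i1, i2, h5.trans ?_⟩
    simpa using i4.app (Eqv.refl (n := n) [x])

theorem wd_colsWord {n : ℕ} {T : List (List ℕ)} (h : KN n T) (h0 : numTwoCols T = 0) :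
    wd T = (colsWord T).reverse := by
  induction T with
  | nil => rfl
  | cons C T ih =>
    rcases col_cases h.1 with ⟨r, rfl, hr⟩ | ⟨r, s, rfl, hr⟩
    · rw [n2_one] at h0
      have := ih h.2.2 h0
      simp only [wd, this]
      simp [colsWord]
    · rw [n2_two] at h0; omega

/-- insertion followed by reverse bumping is a crystal equivalence -/
theorem rule_main {n : ℕ} (hn : 2 ≤ n) (w u : List ℕ) (hw : w.Pairwise (· ≤ ·))
    (hwr : ∀ x ∈ w, 1 ≤ x ∧ x ≤ 2 * n) (hu : u.Pairwise (· ≤ ·))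
    (hur : ∀ x ∈ u, 1 ≤ x ∧ x ≤ 2 * n) (hh : 1 ∈ w → 2 * n ∉ u) (P : List (List ℕ))
    (hP : P = insertWord n u (rowCols w)) (Q1 Q2 : List (List ℕ) × List ℕ)
    (hQ1 : Q1 = rbIter (rbFirst n) (w.length - numTwoCols P) P)
    (hQ2 : Q2 = rbIter (rbSecond n) (numTwoCols P) Q1.1) :
    KN n P ∧ Eqv n (w.reverse ++ u.reverse) (wd P) ∧
    Eqv n (wd P) ((colsWord Q2.1).reverse ++ (Q1.2 ++ Q2.2).reverse) := by
  obtain ⟨h1, h2, h3, h4⟩ := fwd_main hn w u hw hwr hu hur hh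
  rw [← hP] at h1 h2 h3 h4
  have hm : numTwoCols P ≤ P.length := by
    unfold numTwoCols; exact List.length_filter_le _ _
  obtain ⟨i1, i2, i3, i4⟩ := rbIter1 hn (w.length - numTwoCols P) P h1 (by omega)
  rw [← hQ1] at i1 i2 i3 i4
  obtain ⟨j1, j2, j3⟩ := rbIter2 hn (numTwoCols P) Q1.1 i1 i2.symm
  rw [← hQ2] at j1 j2 j3
  refine ⟨h1, h2, i4.trans ?_⟩
  rw [← wd_colsWord j1 j2]
  simpa using j3.app (Eqv.refl (n := n) Q1.2.reverse)

theorem foldr_app (L : List (List ℕ)) : L.foldr (· ++ ·) [] = L.flatten := by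
  induction L with
  | nil => rfl
  | cons a L ih => simp [ih]

theorem cw_eq (n : ℕ) (b : Tup n) : coreWord n b =
    ((List.finRange n).map (fun i => List.replicate (b.1 i) ((i : ℕ) + 1))).flatten ++
    ((List.finRange n).reverse.map
      (fun i => List.replicate (b.2 i) (bar n ((i : ℕ) + 1)))).flatten := by
  unfold coreWord; rw [foldr_app, foldr_app]

theorem cw_count (n : ℕ) (b : Tup n) (a : ℕ) : (coreWord n b).count a =
    (∑ i : Fin n, if (i : ℕ) + 1 = a then b.1 i else 0) +
    (∑ i : Fin n, if bar n ((i : ℕ) + 1) = a then b.2 i else 0) := by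
  rw [cw_eq, List.count_append, List.count_flatten, List.count_flatten, List.map_reverse,
    List.map_reverse, List.sum_reverse, Fin.sum_univ_def, Fin.sum_univ_def, List.map_map, List.map_map]
  simp [Function.comp_def, List.count_replicate]

theorem cw_length (n : ℕ) (b : Tup n) : (coreWord n b).length = tsum b := by
  rw [cw_eq, List.length_append, List.length_flatten, List.length_flatten, List.map_reverse,
    List.map_reverse, List.sum_reverse, List.map_map, List.map_map]
  unfold tsum
  rw [Finset.sum_add_distrib, Fin.sum_univ_def, Fin.sum_univ_def]
  simp [Function.comp_def]

theorem cw_range {n : ℕ} {b : Tup n} {x : ℕ} (hx : x ∈ coreWord n b) : 1 ≤ x ∧ x ≤ 2 * n := by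
  rw [cw_eq] at hx
  simp only [List.mem_append, List.mem_flatten, List.mem_map, List.mem_reverse] at hx
  rcases hx with ⟨_, ⟨i, _, rfl⟩, h⟩ | ⟨_, ⟨i, _, rfl⟩, h⟩
  · have := List.eq_of_mem_replicate h
    omega
  · have := List.eq_of_mem_replicate h
    unfold bar at this
    omega

theorem cw_sorted (n : ℕ) (b : Tup n) : (coreWord n b).Pairwise (· ≤ ·) := by
  rw [cw_eq, List.pairwise_append, List.pairwise_flatten, List.pairwise_flatten]
  refine ⟨⟨?_, ?_⟩, ⟨?_, ?_⟩, ?_⟩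
  · intro l hl
    simp only [List.mem_map] at hl
    obtain ⟨i, _, rfl⟩ := hl
    simp [List.pairwise_replicate]
  · rw [List.pairwise_map]
    refine List.Pairwise.imp ?_ (List.pairwise_lt_finRange n)
    intro i j hij x hx y hy
    rw [List.eq_of_mem_replicate hx, List.eq_of_mem_replicate hy]
    have : (i : ℕ) < j := hij
    omega
  · intro l hl
    simp only [List.mem_map] at hl
    obtain ⟨i, _, rfl⟩ := hl
    simp [List.pairwise_replicate]
  · rw [List.pairwise_map, List.pairwise_reverse]
    refine List.Pairwise.imp ?_ (List.pairwise_lt_finRange n)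
    intro i j hij x hx y hy
    rw [List.eq_of_mem_replicate hx, List.eq_of_mem_replicate hy]
    have : (i : ℕ) < j := hij
    unfold bar
    omega
  · intro x hx y hy
    simp only [List.mem_flatten, List.mem_map, List.mem_reverse] at hx hy
    obtain ⟨_, ⟨i, _, rfl⟩, h⟩ := hx
    obtain ⟨_, ⟨j, _, rfl⟩, h'⟩ := hy
    rw [List.eq_of_mem_replicate h, List.eq_of_mem_replicate h']
    unfold bar
    omega

theorem cw_x {n : ℕ} (b : Tup n) {j : ℕ} (h1 : 1 ≤ j) (h2 : j ≤ n) :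
    (coreWord n b).count j = xc b j := by
  rw [cw_count]
  have : (∑ i : Fin n, if bar n ((i : ℕ) + 1) = j then b.2 i else 0) = 0 := by
    apply Finset.sum_eq_zero
    intro i _
    rw [if_neg]; unfold bar; omega
  rw [this, Finset.sum_eq_single (⟨j - 1, by omega⟩ : Fin n)]
  · unfold xc
    rw [if_pos (by simp; omega), dif_pos (by omega)]; rfl
  · intro i _ hi
    rw [if_neg]
    intro h
    apply hi
    ext; simp; omega
  · simp

theorem cw_xb {n : ℕ} (b : Tup n) {j : ℕ} (h1 : 1 ≤ j) (h2 : j ≤ n) :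
    (coreWord n b).count (2 * n + 1 - j) = xbc b j := by
  rw [cw_count]
  have : (∑ i : Fin n, if (i : ℕ) + 1 = 2 * n + 1 - j then b.1 i else 0) = 0 := by
    apply Finset.sum_eq_zero
    intro i _
    rw [if_neg]; omega
  rw [this, Finset.sum_eq_single (⟨j - 1, by omega⟩ : Fin n)]
  · unfold xbc
    rw [if_pos (by simp [bar]; omega), dif_pos (by omega)]; simp
  · intro i _ hi
    rw [if_neg]
    intro h
    apply hi
    unfold bar at h
    ext; simp; omega
  · simp

theorem tup_ext {n : ℕ} {b b' : Tup n} (h : ∀ j, 1 ≤ j → j ≤ n → xc b j = xc b' j ∧ xbc b j = xbc b' j) :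
    b = b' := by
  apply Prod.ext
  · funext i
    have := (h (i + 1) (by omega) (by omega)).1
    simpa [xc] using this
  · funext i
    have := (h (i + 1) (by omega) (by omega)).2
    simpa [xbc] using this

theorem cw_inj {n : ℕ} {b b' : Tup n} (h : coreWord n b = coreWord n b') : b = b' := by
  apply tup_ext
  intro j h1 h2
  rw [← cw_x b h1 h2, ← cw_x b' h1 h2, ← cw_xb b h1 h2, ← cw_xb b' h1 h2, h]
  exact ⟨rfl, rfl⟩

/-! ### decreasing words -/

def Dec (n : ℕ) (w : List ℕ) : Prop := w.Pairwise (fun a b => b ≤ a) ∧ ∀ x ∈ w, 1 ≤ x ∧ x ≤ 2 * n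

theorem Dec.tail {n a : ℕ} {w : List ℕ} (h : Dec n (a :: w)) : Dec n w :=
  ⟨(List.pairwise_cons.1 h.1).2, fun x hx => h.2 x (List.mem_cons_of_mem _ hx)⟩

theorem Dec.big {n a : ℕ} {w : List ℕ} (h : Dec n (a :: w)) {x : ℕ} (hx : a < x) :
    w.count x = 0 := by
  rw [List.count_eq_zero]
  intro hm
  have := (List.pairwise_cons.1 h.1).1 x hm
  omega

theorem Dec.ext {n : ℕ} {w w' : List ℕ} (h : Dec n w) (h' : Dec n w')
    (hc : ∀ j, 1 ≤ j → j ≤ 2 * n → w.count j = w'.count j) : w = w' := by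
  refine List.Perm.eq_of_pairwise (le := fun a b => b ≤ a) ?_ h.1 h'.1 ?_
  · intro a b _ _ h1 h2; omega
  · rw [List.perm_iff_count]
    intro j
    by_cases hj : 1 ≤ j ∧ j ≤ 2 * n
    · exact hc j hj.1 hj.2
    · rw [List.count_eq_zero.2, List.count_eq_zero.2]
      · exact fun hm => hj (h'.2 j hm)
      · exact fun hm => hj (h.2 j hm)

theorem dec_ep {n i : ℕ} (hi : 1 ≤ i) (hin : i < n) (w : List ℕ) (h : Dec n w) :
    we n i w = w.count (2 * n + 1 - i) + (w.count (i + 1) - w.count (2 * n - i)) ∧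
    wp n i w = w.count i + (w.count (2 * n - i) - w.count (i + 1)) := by
  induction w with
  | nil => simp [we, wp]
  | cons a w ih =>
    obtain ⟨h1, h2⟩ := ih h.tail
    have E : el n i a = (if a = i + 1 then 1 else 0) + (if a = 2 * n + 1 - i then 1 else 0) := by
      unfold el; split_ifs <;> omega
    have P : pl n i a = (if a = i then 1 else 0) + (if a = 2 * n - i then 1 else 0) := by
      unfold pl; split_ifs <;> omega
    simp only [we, wp, List.count_cons, beq_iff_eq]
    have b1 := fun x hx => h.big (x := x) hx
    have b2 := b1 (2 * n + 1 - i)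
    have b3 := b1 (2 * n - i)
    have b4 := b1 (i + 1)
    have b5 := b1 i
    clear b1
    rw [h1, h2, E, P]
    clear h1 h2 E P ih h
    by_cases c1 : a = i + 1
    · have e1 := b2 (by omega)
      have e2 := b3 (by omega)
      rw [if_pos c1, if_neg (show ¬ a = 2 * n + 1 - i by omega), if_neg (show ¬ a = i by omega),
        if_neg (show ¬ a = 2 * n - i by omega), e1, e2]
      omega
    rw [if_neg c1]
    by_cases c2 : a = i
    · have e1 := b2 (by omega)
      have e2 := b3 (by omega)
      have e3 := b4 (by omega)
      rw [if_neg (show ¬ a = 2 * n + 1 - i by omega), if_pos c2,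
        if_neg (show ¬ a = 2 * n - i by omega), e1, e2, e3]
      omega
    rw [if_neg c2]
    by_cases c3 : a = 2 * n - i
    · have e1 := b2 (by omega)
      rw [if_neg (show ¬ a = 2 * n + 1 - i by omega), if_pos c3, e1]
      clear b2 b3 b4 b5
      omega
    · rw [if_neg c3]
      clear b2 b3 b4 b5
      by_cases c4 : a = 2 * n + 1 - i
      · rw [if_pos c4]; omega
      · rw [if_neg c4]; omega

theorem dec_ep_n {n : ℕ} (hn : 1 ≤ n) (w : List ℕ) (h : Dec n w) :
    we n n w = w.count (n + 1) ∧ wp n n w = w.count n := by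
  induction w with
  | nil => simp [we, wp]
  | cons a w ih =>
    obtain ⟨h1, h2⟩ := ih h.tail
    simp only [we, wp, List.count_cons, beq_iff_eq, el, pl]
    have b1 := fun x hx => h.big (x := x) hx
    have b4 := b1 (n + 1)
    have b5 := b1 n
    clear b1
    rw [h1, h2]
    by_cases c1 : a = n
    · have := b4 (by omega)
      split_ifs <;> omega
    · split_ifs <;> omega

theorem wE_mem {n i : ℕ} (w : List ℕ) {x : ℕ} (hx : x ∈ wE n i w) : ∃ y ∈ w, x ≤ y := by
  induction w with
  | nil => simp [wE] at hx
  | cons a w ih =>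
    simp only [wE] at hx
    split_ifs at hx
    · rcases List.mem_cons.1 hx with rfl | hx
      · exact ⟨a, by simp, by omega⟩
      · exact ⟨x, by simp [hx], le_rfl⟩
    · rcases List.mem_cons.1 hx with rfl | hx
      · exact ⟨x, by simp, le_rfl⟩
      · obtain ⟨y, h1, h2⟩ := ih hx
        exact ⟨y, by simp [h1], h2⟩

theorem dec_E {n i : ℕ} (hi : 1 ≤ i) (hin : i ≤ n) (w : List ℕ) (h : Dec n w) (h0 : 0 < we n i w) :
    Dec n (wE n i w) ∧ ∃ y, y = (if i = n ∨ w.count (2 * n - i) < w.count (i + 1) then i + 1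
      else 2 * n + 1 - i) ∧ ∀ j,
      (wE n i w).count j + (if y = j then 1 else 0) = w.count j + (if y - 1 = j then 1 else 0) := by
  induction w with
  | nil => simp [we] at h0
  | cons a w ih =>
    have hw := h.tail
    have hep : (i < n → we n i w = w.count (2 * n + 1 - i) + (w.count (i + 1) - w.count (2 * n - i)))
        ∧ (i = n → we n i w = w.count (i + 1)) := by
      refine ⟨fun hlt => (dec_ep hi hlt w hw).1, ?_⟩
      rintro rfl
      exact (dec_ep_n hi w hw).1
    have b1 := fun x hx => h.big (x := x) hx
    have b2 := b1 (2 * n + 1 - i)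
    have b3 := b1 (2 * n - i)
    have b4 := b1 (i + 1)
    have b5 := b1 i
    clear b1
    have hr := h.2 a (by simp)
    simp only [we] at h0
    have hE : wE n i (a :: w) = if we n i w ≤ pl n i a then (a - 1) :: w else a :: wE n i w := rfl
    rw [hE]
    by_cases h1 : we n i w ≤ pl n i a
    · rw [if_pos h1]
      have h2 := el_le n i a
      have h3 : el n i a = 1 := by omega
      have h4 := pl_of_el hi hin h3
      rw [h4] at h1
      have h5 : a = i + 1 ∨ a + i = 2 * n + 1 := by
        unfold el at h3
        split_ifs at h3 with h5
        exact h5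
      have ha : w.count a = 0 := by
        rcases h5 with h5 | h5
        · rw [h5]
          by_cases hl : i = n
          · have := hep.2 hl; omega
          · have := hep.1 (by omega)
            have := b3 (by omega); omega
        · have : a = 2 * n + 1 - i := by omega
          rw [this]
          by_cases hl : i = n
          · have := hep.2 hl
            have e : 2 * n + 1 - i = i + 1 := by omega
            rw [e]; omega
          · have := hep.1 (by omega)
            omega
      refine ⟨⟨?_, ?_⟩, a, ?_, ?_⟩
      · rw [List.pairwise_cons]
        refine ⟨?_, hw.1⟩
        intro x hx
        have := (List.pairwise_cons.1 h.1).1 x hx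
        have : x ≠ a := by rintro rfl; exact List.count_eq_zero.1 ha hx
        omega
      · intro x hx
        rcases List.mem_cons.1 hx with rfl | hx
        · omega
        · exact hw.2 x hx
      · simp only [List.count_cons, beq_iff_eq]
        rcases h5 with h5 | h5
        · by_cases hl : i = n
          · rw [if_pos (Or.inl hl)]; exact h5
          · have := b3 (by omega)
            rw [if_pos]; · exact h5
            right; rw [this, if_neg (by omega), if_pos h5]; omega
        · by_cases hl : i = n
          · rw [if_pos (Or.inl hl)]; omega
          · have := hep.1 (by omega)
            rw [if_neg]; · omega
            rw [if_neg (show ¬ a = 2 * n - i by omega), if_neg (show ¬ a = i + 1 by omega)]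
            omega
      · intro j
        simp only [List.count_cons, beq_iff_eq]
        omega
    · rw [if_neg h1]
      obtain ⟨i1, y, i2, i3⟩ := ih hw (by omega)
      refine ⟨⟨?_, ?_⟩, y, ?_, ?_⟩
      · rw [List.pairwise_cons]
        refine ⟨?_, i1.1⟩
        intro x hx
        obtain ⟨y, k1, k2⟩ := wE_mem w hx
        have := (List.pairwise_cons.1 h.1).1 y k1
        omega
      · intro x hx
        rcases List.mem_cons.1 hx with rfl | hx
        · exact hr
        · exact i1.2 x hx
      · rw [i2]
        simp only [List.count_cons, beq_iff_eq]
        by_cases hl : i = n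
        · rw [if_pos (Or.inl hl), if_pos (Or.inl hl)]
        · have hh := hep.1 (by omega)
          have : (i = n ∨ w.count (2 * n - i) < w.count (i + 1)) ↔
            (i = n ∨ (w.count (2 * n - i) + if a = 2 * n - i then 1 else 0) <
              (w.count (i + 1) + if a = i + 1 then 1 else 0)) := by
            by_cases c1 : a = 2 * n - i
            · have := b2 (by omega)
              have hp : pl n i a = 1 := by unfold pl; rw [if_pos (by omega)]
              rw [if_pos c1, if_neg (by omega)]
              omega
            · by_cases c2 : a = i + 1
              · have := b2 (by omega)
                have := b3 (by omega)
                rw [if_neg c1, if_pos c2]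
                omega
              · rw [if_neg c1, if_neg c2]; omega
          simp only [this]
      · intro j
        have := i3 j
        simp only [List.count_cons, beq_iff_eq]
        omega

theorem xc_set {n : ℕ} (f g : Fin n → ℕ) (j v m : ℕ) (h1 : 1 ≤ m) (h2 : m ≤ n) :
    xc (setx f j v, g) m = if m = j then v else xc (f, g) m := by
  unfold xc setx
  rw [dif_pos (show m - 1 < n by omega), dif_pos (show m - 1 < n by omega)]
  simp only [Nat.sub_add_cancel h1]
theorem xbc_set {n : ℕ} (f g : Fin n → ℕ) (j v m : ℕ) (h1 : 1 ≤ m) (h2 : m ≤ n) :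
    xbc (f, setx g j v) m = if m = j then v else xbc (f, g) m := by
  unfold xbc setx
  rw [dif_pos (show m - 1 < n by omega), dif_pos (show m - 1 < n by omega)]
  simp only [Nat.sub_add_cancel h1]
theorem xc_fst {n : ℕ} (b : Tup n) (g : Fin n → ℕ) (m : ℕ) : xc (b.1, g) m = xc b m := rfl
theorem xbc_snd {n : ℕ} (b : Tup n) (f : Fin n → ℕ) (m : ℕ) : xbc (f, b.2) m = xbc b m := rfl

theorem sum_set {n : ℕ} (f g : Fin n → ℕ) (j v : ℕ) (h1 : 1 ≤ j) (h2 : j ≤ n) :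
    (∑ t, setx f j v t) + xc (f, g) j = (∑ t, f t) + v := by
  have h : j - 1 < n := by omega
  unfold xc
  rw [dif_pos h, ← Finset.add_sum_erase _ _ (Finset.mem_univ (⟨j - 1, h⟩ : Fin n)),
    ← Finset.add_sum_erase _ f (Finset.mem_univ (⟨j - 1, h⟩ : Fin n))]
  have : ∑ x ∈ Finset.univ.erase (⟨j - 1, h⟩ : Fin n), setx f j v x =
      ∑ x ∈ Finset.univ.erase (⟨j - 1, h⟩ : Fin n), f x := by
    apply Finset.sum_congr rfl
    intro x hx
    unfold setx
    rw [if_neg]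
    intro hxj
    apply (Finset.mem_erase.1 hx).1
    ext; simp; omega
  rw [this]
  simp only [setx, Nat.sub_add_cancel h1, if_true]
  omega

theorem tsum_eq {n : ℕ} (b : Tup n) : tsum b = (∑ t, b.1 t) + ∑ t, b.2 t := by
  unfold tsum; exact Finset.sum_add_distrib

def er (n i : ℕ) (b : Tup n) : ℕ :=
  if i = 0 then xc b 1 + (xc b 2 - xbc b 2) else if i = n then xbc b n else
    xbc b i + (xc b (i + 1) - xbc b (i + 1))
def pr (n i : ℕ) (b : Tup n) : ℕ :=
  if i = 0 then xbc b 1 + (xbc b 2 - xc b 2) else if i = n then xc b n else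
    xc b i + (xbc b (i + 1) - xc b (i + 1))

/-- explicit description of `ẽ_i` through entries -/
theorem eA_char {n i : ℕ} (hn : 2 ≤ n) (hi : i ≤ n) (b : Tup n) :
    (eA n i b = none ∧ er n i b = 0) ∨ ∃ b', eA n i b = some b' ∧ tsum b' = tsum b ∧
      ((i = 0 ∧ xbc b 2 < xc b 2 ∧ ∀ m, 1 ≤ m → m ≤ n →
          (xc b' m = if m = 2 then xc b m - 1 else xc b m) ∧
          (xbc b' m = if m = 1 then xbc b m + 1 else xbc b m)) ∨
       (i = 0 ∧ xc b 2 ≤ xbc b 2 ∧ 0 < xc b 1 ∧ ∀ m, 1 ≤ m → m ≤ n →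
          (xc b' m = if m = 1 then xc b m - 1 else xc b m) ∧
          (xbc b' m = if m = 2 then xbc b m + 1 else xbc b m)) ∨
       (i ≠ 0 ∧ i = n ∧ 0 < xbc b n ∧ ∀ m, 1 ≤ m → m ≤ n →
          (xc b' m = if m = i then xc b m + 1 else xc b m) ∧
          (xbc b' m = if m = i then xbc b m - 1 else xbc b m)) ∨
       (i ≠ 0 ∧ i < n ∧ xbc b (i + 1) < xc b (i + 1) ∧ ∀ m, 1 ≤ m → m ≤ n →
          (xc b' m = if m = i + 1 then xc b m - 1 else if m = i then xc b m + 1 else xc b m) ∧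
          (xbc b' m = xbc b m)) ∨
       (i ≠ 0 ∧ i < n ∧ xc b (i + 1) ≤ xbc b (i + 1) ∧ 0 < xbc b i ∧ ∀ m, 1 ≤ m → m ≤ n →
          (xc b' m = xc b m) ∧
          (xbc b' m = if m = i then xbc b m - 1 else if m = i + 1 then xbc b m + 1 else xbc b m))) := by
  unfold eA er
  by_cases h0 : i = 0
  · rw [if_pos h0, if_pos (show 1 < n by omega), if_pos h0]
    by_cases h1 : xbc b 2 < xc b 2
    · rw [if_pos h1]
      refine Or.inr ⟨_, rfl, ?_, Or.inl ⟨h0, h1, fun m m1 m2 => ?_⟩⟩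
      · rw [tsum_eq, tsum_eq]
        have e1 := sum_set b.1 b.2 2 (xc b 2 - 1) (by omega) (by omega)
        have e2 := sum_set b.2 b.1 1 (xbc b 1 + 1) (by omega) (by omega)
        have e3 : xc (b.1, b.2) 2 = xc b 2 := rfl
        have e4 : xc (b.2, b.1) 1 = xbc b 1 := rfl
        simp only; omega
      · rw [xc_set _ _ _ _ _ m1 m2, xbc_set _ _ _ _ _ m1 m2]
        simp only [xc_fst, xbc_snd]
        refine ⟨?_, ?_⟩ <;> split_ifs with h <;> first | rfl | rw [h]
    · rw [if_neg h1]
      by_cases h2 : 0 < xc b 1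
      · rw [if_pos h2]
        refine Or.inr ⟨_, rfl, ?_, Or.inr (Or.inl ⟨h0, by omega, h2, fun m m1 m2 => ?_⟩)⟩
        · rw [tsum_eq, tsum_eq]
          have e1 := sum_set b.1 b.2 1 (xc b 1 - 1) (by omega) (by omega)
          have e2 := sum_set b.2 b.1 2 (xbc b 2 + 1) (by omega) (by omega)
          have e3 : xc (b.1, b.2) 1 = xc b 1 := rfl
          have e4 : xc (b.2, b.1) 2 = xbc b 2 := rfl
          simp only; omega
        · rw [xc_set _ _ _ _ _ m1 m2, xbc_set _ _ _ _ _ m1 m2]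
          simp only [xc_fst, xbc_snd]
          refine ⟨?_, ?_⟩ <;> split_ifs with h <;> first | rfl | rw [h]
      · rw [if_neg h2]
        exact Or.inl ⟨rfl, by omega⟩
  rw [if_neg h0, if_neg h0]
  by_cases hin : i = n
  · rw [if_pos hin, if_pos hin]
    by_cases h1 : 0 < xbc b n
    · rw [if_pos h1]
      refine Or.inr ⟨_, rfl, ?_, Or.inr (Or.inr (Or.inl ⟨h0, hin, h1, fun m m1 m2 => ?_⟩))⟩
      · rw [tsum_eq, tsum_eq]
        have e1 := sum_set b.1 b.2 n (xc b n + 1) (by omega) (by omega)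
        have e2 := sum_set b.2 b.1 n (xbc b n - 1) (by omega) (by omega)
        have e3 : xc (b.1, b.2) n = xc b n := rfl
        have e4 : xc (b.2, b.1) n = xbc b n := rfl
        simp only; omega
      · rw [xc_set _ _ _ _ _ m1 m2, xbc_set _ _ _ _ _ m1 m2]
        simp only [xc_fst, xbc_snd, hin]
        refine ⟨?_, ?_⟩ <;> split_ifs with h <;> first | rfl | rw [h]
    · rw [if_neg h1]
      exact Or.inl ⟨rfl, by omega⟩
  rw [if_neg hin, if_neg hin, if_pos (show i < n by omega)]
  by_cases h1 : xbc b (i + 1) < xc b (i + 1)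
  · rw [if_pos h1]
    refine Or.inr ⟨_, rfl, ?_, Or.inr (Or.inr (Or.inr (Or.inl ⟨h0, by omega, h1, fun m m1 m2 => ?_⟩)))⟩
    · rw [tsum_eq, tsum_eq]
      have e1 := sum_set b.1 b.2 i (xc b i + 1) (by omega) (by omega)
      have e2 := sum_set (setx b.1 i (xc b i + 1)) b.2 (i + 1) (xc b (i + 1) - 1) (by omega) (by omega)
      rw [xc_set _ _ _ _ _ (by omega) (by omega), if_neg (by omega)] at e2
      simp only [xc_fst] at e1 e2
      simp only; omega
    · rw [xc_set _ _ _ _ _ m1 m2, xc_set _ _ _ _ _ m1 m2]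
      simp only [xc_fst, xbc_snd]
      refine ⟨?_, ?_⟩
      · by_cases k1 : m = i + 1
        · rw [if_pos k1, if_pos k1, k1]
        · rw [if_neg k1, if_neg k1]
          by_cases k2 : m = i
          · rw [if_pos k2, if_pos k2, k2]
          · rw [if_neg k2, if_neg k2]
      · trivial
  · rw [if_neg h1]
    by_cases h2 : 0 < xbc b i
    · rw [if_pos h2]
      refine Or.inr ⟨_, rfl, ?_, Or.inr (Or.inr (Or.inr (Or.inr ⟨h0, by omega, by omega, h2, fun m m1 m2 => ?_⟩)))⟩
      · rw [tsum_eq, tsum_eq]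
        have e1 := sum_set b.2 b.1 (i + 1) (xbc b (i + 1) + 1) (by omega) (by omega)
        have e2 := sum_set (setx b.2 (i + 1) (xbc b (i + 1) + 1)) b.1 i (xbc b i - 1) (by omega) (by omega)
        rw [xc_set _ _ _ _ _ (by omega) (by omega), if_neg (by omega)] at e2
        have e3 : xc (b.2, b.1) (i + 1) = xbc b (i + 1) := rfl
        have e4 : xc (b.2, b.1) i = xbc b i := rfl
        simp only; omega
      · rw [xbc_set _ _ _ _ _ m1 m2, xbc_set _ _ _ _ _ m1 m2]
        simp only [xc_fst, xbc_snd]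
        refine ⟨trivial, ?_⟩
        by_cases k1 : m = i
        · rw [if_pos k1, if_pos k1, k1]
        · rw [if_neg k1, if_neg k1]
          by_cases k2 : m = i + 1
          · rw [if_pos k2, if_pos k2, k2]
          · rw [if_neg k2, if_neg k2]
    · rw [if_neg h2]
      exact Or.inl ⟨rfl, by omega⟩

theorem eA_none {n i : ℕ} (hn : 2 ≤ n) (hi : i ≤ n) (b : Tup n) (h : eA n i b = none) :
    er n i b = 0 := by
  rcases eA_char hn hi b with ⟨_, h2⟩ | ⟨b', h1, _⟩
  · exact h2
  · rw [h] at h1; simp at h1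

theorem eA_some {n i : ℕ} (hn : 2 ≤ n) (hi : i ≤ n) (b b' : Tup n) (h : eA n i b = some b') :
    er n i b = er n i b' + 1 ∧ pr n i b' = pr n i b + 1 ∧ tsum b' = tsum b := by
  rcases eA_char hn hi b with ⟨h1, h2⟩ | ⟨b'', h1, h2, h3⟩
  · rw [h] at h1; simp at h1
  rw [h] at h1
  obtain rfl : b' = b'' := by simpa using h1
  unfold er pr
  rcases h3 with ⟨k1, k2, k3⟩ | ⟨k1, k2, k4, k3⟩ | ⟨k0, k1, k2, k3⟩ | ⟨k0, k1, k2, k3⟩ | ⟨k0, k1, k2, k4, k3⟩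
  · have e1 := k3 1 (by omega) (by omega)
    have e2 := k3 2 (by omega) (by omega)
    simp at e1 e2
    simp only [if_pos k1]
    omega
  · have e1 := k3 1 (by omega) (by omega)
    have e2 := k3 2 (by omega) (by omega)
    simp at e1 e2
    simp only [if_pos k1]
    omega
  · have e1 := k3 n (by omega) (by omega)
    rw [if_pos k1.symm, if_pos k1.symm] at e1
    simp only [if_neg k0, if_pos k1]
    omega
  · have e1 := k3 i (by omega) (by omega)
    have e2 := k3 (i + 1) (by omega) (by omega)
    simp at e1 e2
    simp only [if_neg k0, if_neg (show ¬ i = n by omega)]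
    omega
  · have e1 := k3 i (by omega) (by omega)
    have e2 := k3 (i + 1) (by omega) (by omega)
    simp at e1 e2
    simp only [if_neg k0, if_neg (show ¬ i = n by omega)]
    omega

theorem setx_comm {n : ℕ} (f : Fin n → ℕ) (j v j' w : ℕ) (h : j ≠ j') :
    setx (setx f j v) j' w = setx (setx f j' w) j v := by
  funext t; unfold setx; split_ifs <;> first | omega | rfl

theorem fA_swap (n i : ℕ) (b : Tup n) : fA n i b = (eA n i b.swap).map Prod.swap := by
  have x1 : ∀ j, xc b.swap j = xbc b j := fun _ => rfl
  have x2 : ∀ j, xbc b.swap j = xc b j := fun _ => rfl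
  unfold fA eA
  simp only [x1, x2, Prod.fst_swap, Prod.snd_swap]
  by_cases h0 : i = 0
  · simp only [if_pos h0]
    split_ifs <;> first | omega | rfl
  simp only [if_neg h0]
  by_cases h1 : i = n
  · simp only [if_pos h1]
    split_ifs <;> first | omega | rfl
  simp only [if_neg h1]
  by_cases h2 : i < n
  · simp only [if_pos h2]
    rw [setx_comm b.1 i _ (i + 1) _ (by omega)]
    rw [setx_comm b.2 i _ (i + 1) _ (by omega)]
    split_ifs <;> first | omega | rfl
  · simp only [if_neg h2]; rfl

theorem er_swap (n i : ℕ) (b : Tup n) : er n i b.swap = pr n i b := rfl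
theorem pr_swap (n i : ℕ) (b : Tup n) : pr n i b.swap = er n i b := rfl
theorem tsum_swap {n : ℕ} (b : Tup n) : tsum b.swap = tsum b := by
  rw [tsum_eq, tsum_eq]; simp; omega

theorem fA_none {n i : ℕ} (hn : 2 ≤ n) (hi : i ≤ n) (b : Tup n) (h : fA n i b = none) :
    pr n i b = 0 := by
  rw [fA_swap, Option.map_eq_none_iff] at h
  exact eA_none hn hi _ h

theorem fA_some {n i : ℕ} (hn : 2 ≤ n) (hi : i ≤ n) (b b' : Tup n) (h : fA n i b = some b') :
    pr n i b = pr n i b' + 1 ∧ er n i b' = er n i b + 1 ∧ tsum b' = tsum b := by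
  rw [fA_swap, Option.map_eq_some_iff] at h
  obtain ⟨c, h1, rfl⟩ := h
  have := eA_some hn hi _ _ h1
  rw [er_swap, pr_swap, tsum_swap] at this
  exact ⟨this.1, this.2.1, by rw [tsum_swap]; exact this.2.2⟩

theorem iter_none {α : Type} (op : α → Option α) (m : ℕ) :
    (fun o => Option.bind o op)^[m] none = none := by
  induction m with
  | zero => rfl
  | succ m ih => rw [Function.iterate_succ_apply]; exact ih

theorem iter_rank {α : Type} (op : α → Option α) (r : α → ℕ)
    (h0 : ∀ a, op a = none → r a = 0) (h1 : ∀ a b, op a = some b → r a = r b + 1) (a : α) :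
    sSup {m | (fun o => Option.bind o op)^[m] (some a) ≠ none} = r a := by
  have key : ∀ m a, (fun o => Option.bind o op)^[m] (some a) ≠ none ↔ m ≤ r a := by
    intro m
    induction m with
    | zero => intro a; simp
    | succ m ih =>
      intro a
      rw [Function.iterate_succ_apply]
      have : (Option.bind (some a) op) = op a := rfl
      rw [this]
      cases h : op a with
      | none => rw [iter_none]; have := h0 a h; simp; omega
      | some b => rw [ih b]; have := h1 a b h; omega
  have : {m | (fun o => Option.bind o op)^[m] (some a) ≠ none} = Set.Iic (r a) := by
    ext m; exact key m a
  rw [this]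
  exact csSup_Iic

theorem epsA_eq {n i : ℕ} (hn : 2 ≤ n) (hi : i ≤ n) (b : Tup n) : epsA n i b = er n i b :=
  iter_rank (eA n i) (er n i) (eA_none hn hi) (fun a b h => (eA_some hn hi a b h).1) b
theorem phiA_eq {n i : ℕ} (hn : 2 ≤ n) (hi : i ≤ n) (b : Tup n) : phiA n i b = pr n i b :=
  iter_rank (fA n i) (pr n i) (fA_none hn hi) (fun a b h => (fA_some hn hi a b h).1) b

/-! tensor ranks -/
abbrev T2 (n : ℕ) := Tup n × Tup n
def ter (n i : ℕ) (u : T2 n) : ℕ := er n i u.1 + (er n i u.2 - pr n i u.1)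
def tpr (n i : ℕ) (u : T2 n) : ℕ := pr n i u.2 + (pr n i u.1 - er n i u.2)

theorem eTen_none {n i : ℕ} (hn : 2 ≤ n) (hi : i ≤ n) (u : T2 n) (h : eTenA n i u = none) :
    ter n i u = 0 := by
  unfold eTenA at h
  rw [epsA_eq hn hi, phiA_eq hn hi] at h
  unfold ter
  split_ifs at h with h1
  · rw [Option.map_eq_none_iff] at h
    have := eA_none hn hi _ h
    omega
  · rw [Option.map_eq_none_iff] at h
    have := eA_none hn hi _ h
    omega

theorem eTen_some {n i : ℕ} (hn : 2 ≤ n) (hi : i ≤ n) (u v : T2 n) (h : eTenA n i u = some v) :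
    ter n i u = ter n i v + 1 ∧ tpr n i v = tpr n i u + 1 ∧ tsum v.1 = tsum u.1 ∧
      tsum v.2 = tsum u.2 ∧
      ((er n i u.2 ≤ pr n i u.1 ∧ eA n i u.1 = some v.1 ∧ v.2 = u.2) ∨
       (pr n i u.1 < er n i u.2 ∧ eA n i u.2 = some v.2 ∧ v.1 = u.1)) := by
  unfold eTenA at h
  rw [epsA_eq hn hi, phiA_eq hn hi] at h
  unfold ter tpr
  split_ifs at h with h1
  · rw [Option.map_eq_some_iff] at h
    obtain ⟨c, h2, rfl⟩ := h
    have := eA_some hn hi _ _ h2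
    refine ⟨by simp only; omega, by simp only; omega, this.2.2, rfl, Or.inl ⟨h1, h2, rfl⟩⟩
  · rw [Option.map_eq_some_iff] at h
    obtain ⟨c, h2, rfl⟩ := h
    have := eA_some hn hi _ _ h2
    refine ⟨by simp only; omega, by simp only; omega, rfl, this.2.2, Or.inr ⟨by omega, h2, rfl⟩⟩

theorem fTen_none {n i : ℕ} (hn : 2 ≤ n) (hi : i ≤ n) (u : T2 n) (h : fTenA n i u = none) :
    tpr n i u = 0 := by
  unfold fTenA at h
  rw [epsA_eq hn hi, phiA_eq hn hi] at h
  unfold tpr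
  split_ifs at h with h1
  · rw [Option.map_eq_none_iff] at h
    have := fA_none hn hi _ h
    omega
  · rw [Option.map_eq_none_iff] at h
    have := fA_none hn hi _ h
    omega

theorem fTen_some {n i : ℕ} (hn : 2 ≤ n) (hi : i ≤ n) (u v : T2 n) (h : fTenA n i u = some v) :
    tpr n i u = tpr n i v + 1 ∧ tsum v.1 = tsum u.1 ∧ tsum v.2 = tsum u.2 := by
  unfold fTenA at h
  rw [epsA_eq hn hi, phiA_eq hn hi] at h
  unfold tpr
  split_ifs at h with h1
  · rw [Option.map_eq_some_iff] at h
    obtain ⟨c, h2, rfl⟩ := h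
    have := fA_some hn hi _ _ h2
    refine ⟨by simp only; omega, this.2.2, rfl⟩
  · rw [Option.map_eq_some_iff] at h
    obtain ⟨c, h2, rfl⟩ := h
    have := fA_some hn hi _ _ h2
    refine ⟨by simp only; omega, rfl, this.2.2⟩

/-! words of tuples -/
def rw' (n : ℕ) (b : Tup n) : List ℕ := (coreWord n b).reverse
def W (n : ℕ) (u : T2 n) : List ℕ := rw' n u.1 ++ rw' n u.2

theorem rw_dec (n : ℕ) (b : Tup n) : Dec n (rw' n b) := by
  refine ⟨?_, ?_⟩
  · unfold rw'; rw [List.pairwise_reverse]; exact cw_sorted n b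
  · intro x hx; unfold rw' at hx; rw [List.mem_reverse] at hx; exact cw_range hx

theorem rw_x {n : ℕ} (b : Tup n) {j : ℕ} (h1 : 1 ≤ j) (h2 : j ≤ n) :
    (rw' n b).count j = xc b j := by
  unfold rw'; rw [List.count_reverse]; exact cw_x b h1 h2
theorem rw_xb {n : ℕ} (b : Tup n) {j : ℕ} (h1 : 1 ≤ j) (h2 : j ≤ n) :
    (rw' n b).count (2 * n + 1 - j) = xbc b j := by
  unfold rw'; rw [List.count_reverse]; exact cw_xb b h1 h2
theorem rw_len {n : ℕ} (b : Tup n) : (rw' n b).length = tsum b := by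
  unfold rw'; rw [List.length_reverse]; exact cw_length n b

theorem er_we {n i : ℕ} (h1 : 1 ≤ i) (h2 : i ≤ n) (b : Tup n) :
    er n i b = we n i (rw' n b) ∧ pr n i b = wp n i (rw' n b) := by
  unfold er pr
  rw [if_neg (show ¬ i = 0 by omega), if_neg (show ¬ i = 0 by omega)]
  by_cases h : i = n
  · subst h
    rw [if_pos rfl, if_pos rfl, (dec_ep_n h1 _ (rw_dec i b)).1, (dec_ep_n h1 _ (rw_dec i b)).2,
      rw_x b h1 h2, ← rw_xb b h1 h2]
    have : 2 * i + 1 - i = i + 1 := by omega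
    rw [this]; exact ⟨rfl, rfl⟩
  · have := dec_ep h1 (by omega : i < n) _ (rw_dec n b)
    rw [this.1, this.2, if_neg h, if_neg h, rw_xb b h1 h2, rw_x b h1 h2,
      rw_x b (by omega) (by omega)]
    have e := rw_xb b (j := i + 1) (by omega) (by omega)
    have : 2 * n + 1 - (i + 1) = 2 * n - i := by omega
    rw [this] at e
    rw [e]; exact ⟨rfl, rfl⟩

theorem rw_eA {n i : ℕ} (hn : 2 ≤ n) (h1 : 1 ≤ i) (h2 : i ≤ n) (b b' : Tup n)
    (h : eA n i b = some b') : rw' n b' = wE n i (rw' n b) := by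
  have h0 : 0 < we n i (rw' n b) := by
    rw [← (er_we h1 h2 b).1, (eA_some hn h2 b b' h).1]; omega
  obtain ⟨d1, y, d2, d3⟩ := dec_E h1 h2 _ (rw_dec n b) h0
  refine Dec.ext (rw_dec n b') d1 ?_
  intro j j1 j2
  have d4 := d3 j
  have hxb : ∀ (c : Tup n) m, 1 ≤ m → m ≤ n → (rw' n c).count (2 * n + 1 - m) = xbc c m :=
    fun c m m1 m2 => rw_xb c m1 m2
  rcases eA_char hn h2 b with ⟨k1, k2⟩ | ⟨b'', k1, k2, k3⟩
  · rw [h] at k1; simp at k1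
  rw [h] at k1
  obtain rfl : b' = b'' := by simpa using k1
  have hj : ∀ c : Tup n, (rw' n c).count j = if j ≤ n then xc c j else xbc c (2 * n + 1 - j) := by
    intro c
    split_ifs with hj
    · exact rw_x c j1 hj
    · rw [← rw_xb c (by omega) (by omega)]; congr 1; omega
  rw [hj b] at d4
  rw [hj b']
  rcases k3 with ⟨e0, _⟩ | ⟨e0, _⟩ | ⟨e0, e1, e2, e3⟩ | ⟨e0, e1, e2, e3⟩ | ⟨e0, e1, e2, e4, e3⟩
  · omega
  · omega
  · rw [if_pos (Or.inl e1)] at d2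
    subst d2
    by_cases q : j ≤ n
    · rw [if_pos q] at d4 ⊢
      rw [(e3 j j1 q).1]; split_ifs at d4 ⊢ <;> omega
    · rw [if_neg q] at d4 ⊢
      rw [(e3 (2 * n + 1 - j) (by omega) (by omega)).2]
      have : i = 2 * n + 1 - j → 0 < xbc b (2 * n + 1 - j) := by
        intro hh; rw [← hh, e1]; exact e2
      split_ifs at d4 ⊢ <;> omega
  · have f1 := rw_x b (j := i + 1) (by omega) (by omega)
    have f2 := rw_xb b (j := i + 1) (by omega) (by omega)
    rw [show 2 * n + 1 - (i + 1) = 2 * n - i by omega] at f2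
    rw [if_pos (Or.inr (by omega))] at d2
    subst d2
    by_cases q : j ≤ n
    · rw [if_pos q] at d4 ⊢
      rw [(e3 j j1 q).1]
      have : j = i + 1 → 0 < xc b j := by rintro rfl; omega
      split_ifs at d4 ⊢ <;> omega
    · rw [if_neg q] at d4 ⊢
      rw [(e3 (2 * n + 1 - j) (by omega) (by omega)).2]
      split_ifs at d4 ⊢ <;> omega
  · have f1 := rw_x b (j := i + 1) (by omega) (by omega)
    have f2 := rw_xb b (j := i + 1) (by omega) (by omega)
    rw [show 2 * n + 1 - (i + 1) = 2 * n - i by omega] at f2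
    rw [if_neg (by omega)] at d2
    subst d2
    by_cases q : j ≤ n
    · rw [if_pos q] at d4 ⊢
      rw [(e3 j j1 q).1]
      split_ifs at d4 ⊢ <;> omega
    · rw [if_neg q] at d4 ⊢
      rw [(e3 (2 * n + 1 - j) (by omega) (by omega)).2]
      have : i = 2 * n + 1 - j → 0 < xbc b (2 * n + 1 - j) := by
        intro hh; rw [← hh]; exact e4
      split_ifs at d4 ⊢ <;> omega

theorem ter_we {n i : ℕ} (h1 : 1 ≤ i) (h2 : i ≤ n) (u : T2 n) :
    ter n i u = we n i (W n u) ∧ tpr n i u = wp n i (W n u) := by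
  unfold ter tpr W
  rw [(we_app _ _ _ _).1, (we_app _ _ _ _).2, (er_we h1 h2 u.1).1, (er_we h1 h2 u.1).2,
    (er_we h1 h2 u.2).1, (er_we h1 h2 u.2).2]
  exact ⟨rfl, rfl⟩

theorem W_eTen {n i : ℕ} (hn : 2 ≤ n) (h1 : 1 ≤ i) (h2 : i ≤ n) (u v : T2 n)
    (h : eTenA n i u = some v) : W n v = wE n i (W n u) := by
  obtain ⟨k1, -, -, -, k2⟩ := eTen_some hn h2 u v h
  have h0 : 0 < we n i (W n u) := by rw [← (ter_we h1 h2 u).1]; omega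
  unfold W at h0 ⊢
  rw [wE_app _ _ _ _ h0, ← (er_we h1 h2 u.2).1, ← (er_we h1 h2 u.1).2]
  rcases k2 with ⟨c1, c2, c3⟩ | ⟨c1, c2, c3⟩
  · rw [if_pos c1, rw_eA hn h1 h2 _ _ c2, c3]
  · rw [if_neg (by omega), rw_eA hn h1 h2 _ _ c2, c3]

theorem rw_inj {n : ℕ} {b b' : Tup n} (h : rw' n b = rw' n b') : b = b' := by
  unfold rw' at h
  exact cw_inj (List.reverse_inj.1 h)
theorem W_inj {n : ℕ} {u v : T2 n} (h : W n u = W n v) (h1 : tsum u.1 = tsum v.1) : u = v := by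
  unfold W at h
  obtain ⟨a, b⟩ := List.append_inj h (by rw [rw_len, rw_len, h1])
  exact Prod.ext (rw_inj a) (rw_inj b)

theorem tri_x {n : ℕ} (hn : 2 ≤ n) (a c d : ℕ) {j : ℕ} (h1 : 1 ≤ j) (h2 : j ≤ n) :
    xc (tripleVec n a c d) j = (if j = 1 then a else if j = 2 then c else 0) ∧
    xbc (tripleVec n a c d) j = (if j = 1 then d else 0) := by
  unfold xc xbc tripleVec
  rw [dif_pos (by omega), dif_pos (by omega)]
  simp only
  have e1 : (j - 1 = 0) ↔ j = 1 := by omega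
  have e2 : (j - 1 = 1) ↔ j = 2 := by omega
  simp only [e1, e2]
  exact ⟨trivial, trivial⟩

theorem tri_x1 {n : ℕ} (hn : 2 ≤ n) (a c d : ℕ) : xc (tripleVec n a c d) 1 = a := by
  rw [(tri_x hn a c d (by omega) (by omega)).1]; rfl
theorem tri_x2 {n : ℕ} (hn : 2 ≤ n) (a c d : ℕ) : xc (tripleVec n a c d) 2 = c := by
  rw [(tri_x hn a c d (by omega) (by omega)).1]; rfl
theorem tri_b1 {n : ℕ} (hn : 2 ≤ n) (a c d : ℕ) : xbc (tripleVec n a c d) 1 = d := by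
  rw [(tri_x hn a c d (by omega) (by omega)).2]; rfl
theorem tri_b2 {n : ℕ} (hn : 2 ≤ n) (a c d : ℕ) : xbc (tripleVec n a c d) 2 = 0 := by
  rw [(tri_x hn a c d (by omega) (by omega)).2]; rfl

theorem tri_sum {n : ℕ} (hn : 2 ≤ n) (a c d : ℕ) : tsum (tripleVec n a c d) = a + c + d := by
  obtain ⟨m, rfl⟩ : ∃ m, n = m + 2 := ⟨n - 2, by omega⟩
  unfold tsum tripleVec
  simp [Fin.sum_univ_succ]
  omega

theorem uvec_tri (n v : ℕ) : uvec n v = tripleVec n v 0 0 := by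
  unfold uvec tripleVec
  simp
theorem barvec_tri (n v : ℕ) : barvec n v = tripleVec n 0 0 v := by
  unfold barvec tripleVec
  simp

/-- highest elements -/
def hwv (n l a c d : ℕ) : T2 n := (tripleVec n l 0 0, tripleVec n a c d)

theorem hw_class {n : ℕ} (hn : 2 ≤ n) (u : T2 n) (h : ∀ i, 1 ≤ i → i ≤ n → ter n i u = 0) :
    ∃ a c d, u = hwv n (tsum u.1) a c d ∧ a + c + d = tsum u.2 ∧ c + d ≤ tsum u.1 := by
  have er1 : ∀ i, 1 ≤ i → i ≤ n → er n i u.1 = 0 ∧ er n i u.2 ≤ pr n i u.1 := by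
    intro i h1 h2
    have := h i h1 h2
    unfold ter at this; omega
  have hb : ∀ j, 1 ≤ j → j ≤ n → xbc u.1 j = 0 ∧ (2 ≤ j → xc u.1 j = 0) := by
    intro j h1 h2
    have a1 : xbc u.1 j = 0 := by
      have := (er1 j h1 h2).1
      unfold er at this
      rw [if_neg (show ¬ j = 0 by omega)] at this
      by_cases q : j = n
      · rw [if_pos q] at this; rw [q]; exact this
      · rw [if_neg q] at this; omega
    refine ⟨a1, fun h3 => ?_⟩
    have := (er1 (j - 1) (by omega) (by omega)).1
    unfold er at this
    rw [if_neg (show ¬ j - 1 = 0 by omega), if_neg (show ¬ j - 1 = n by omega),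
      show j - 1 + 1 = j by omega] at this
    omega
  have hpr : ∀ i, 2 ≤ i → i ≤ n → pr n i u.1 = 0 := by
    intro i h1 h2
    have a1 := (hb i (by omega) h2).2 h1
    unfold pr
    rw [if_neg (show ¬ i = 0 by omega)]
    by_cases q : i = n
    · rw [if_pos q]; rw [q] at a1; exact a1
    · rw [if_neg q, a1, (hb (i + 1) (by omega) (by omega)).1]; omega
  have e1 : u.1 = tripleVec n (xc u.1 1) 0 0 := by
    apply tup_ext
    intro j h1 h2
    rw [(tri_x hn _ _ _ h1 h2).1, (tri_x hn _ _ _ h1 h2).2]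
    have := hb j h1 h2
    by_cases q : j = 1
    · subst q; simp [this]
    · simp [q, this, this.2 (by omega)]
  have hb2 : ∀ j, 1 ≤ j → j ≤ n → (2 ≤ j → xbc u.2 j = 0) ∧ (3 ≤ j → xc u.2 j = 0) := by
    intro j h1 h2
    have a1 : 2 ≤ j → xbc u.2 j = 0 := by
      intro h3
      have := (er1 j h1 h2).2
      rw [hpr j h3 h2] at this
      unfold er at this
      rw [if_neg (show ¬ j = 0 by omega)] at this
      by_cases q : j = n
      · rw [if_pos q] at this; rw [q]; omega
      · rw [if_neg q] at this; omega
    refine ⟨a1, fun h3 => ?_⟩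
    have := (er1 (j - 1) (by omega) (by omega)).2
    rw [hpr (j - 1) (by omega) (by omega)] at this
    unfold er at this
    rw [if_neg (show ¬ j - 1 = 0 by omega), if_neg (show ¬ j - 1 = n by omega),
      show j - 1 + 1 = j by omega] at this
    have := a1 (by omega)
    omega
  have e2 : u.2 = tripleVec n (xc u.2 1) (xc u.2 2) (xbc u.2 1) := by
    apply tup_ext
    intro j h1 h2
    rw [(tri_x hn _ _ _ h1 h2).1, (tri_x hn _ _ _ h1 h2).2]
    have := hb2 j h1 h2
    by_cases q : j = 1
    · subst q; simp
    · by_cases q2 : j = 2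
      · subst q2; simp [this.1]
      · simp [q, q2, this.1 (by omega), this.2 (by omega)]
  have s1 : tsum u.1 = xc u.1 1 := by
    conv_lhs => rw [e1]
    rw [tri_sum hn]; rfl
  have s2 : tsum u.2 = xc u.2 1 + xc u.2 2 + xbc u.2 1 := by
    conv_lhs => rw [e2]
    rw [tri_sum hn]
  refine ⟨xc u.2 1, xc u.2 2, xbc u.2 1, ?_, s2.symm, ?_⟩
  · unfold hwv; rw [s1]; exact Prod.ext e1 e2
  · have := (er1 1 (by omega) (by omega)).2
    unfold er pr at this
    simp only [if_neg (show ¬ 1 = 0 by omega), if_neg (show ¬ 1 = n by omega)] at this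
    have a1 := hb 2 (by omega) (by omega)
    have a2 := hb2 2 (by omega) (by omega)
    simp only [show 1 + 1 = 2 from rfl, a1.1, a2.1 (by omega)] at this
    omega

theorem hw_tpr {n : ℕ} (hn : 2 ≤ n) (l a c d : ℕ) :
    tpr n 1 (hwv n l a c d) = a + (l - (d + c)) ∧ tpr n 2 (hwv n l a c d) = c := by
  unfold tpr hwv
  simp only
  have p1 : ∀ a c d, pr n 1 (tripleVec n a c d) = a ∧ er n 1 (tripleVec n a c d) = d + c := by
    intro a c d
    unfold er pr
    simp only [if_neg (show ¬ 1 = 0 by omega), if_neg (show ¬ 1 = n by omega),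
      show 1 + 1 = 2 from rfl, tri_x1 hn, tri_x2 hn, tri_b1 hn, tri_b2 hn]
    omega
  have p2 : ∀ a c d, pr n 2 (tripleVec n a c d) = c ∧ er n 2 (tripleVec n a c d) = 0 := by
    intro a c d
    unfold er pr
    simp only [if_neg (show ¬ 2 = 0 by omega)]
    by_cases q : 2 = n
    · rw [if_pos q, if_pos q, ← q, q, ← q]
      exact ⟨tri_x2 (by omega) _ _ _, tri_b2 (by omega) _ _ _⟩
    · rw [if_neg q, if_neg q, tri_x2 hn, tri_b2 hn,
        (tri_x hn a c d (j := 2 + 1) (by omega) (by omega)).1,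
        (tri_x hn a c d (j := 2 + 1) (by omega) (by omega)).2]
      simp
  rw [(p1 _ _ _).1, (p1 _ _ _).1, (p1 _ _ _).2, (p2 _ _ _).1, (p2 _ _ _).1, (p2 _ _ _).2]
  omega

theorem eTen_pos {n i : ℕ} (hn : 2 ≤ n) (hi : i ≤ n) (u : T2 n) (h : 0 < ter n i u) :
    ∃ v, eTenA n i u = some v := by
  cases h' : eTenA n i u with
  | none => rw [eTen_none hn hi u h'] at h; omega
  | some v => exact ⟨v, rfl⟩

theorem uniq {n : ℕ} (hn : 2 ≤ n) (m : ℕ) (x y : T2 n) (hm : (W n x).sum = m)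
    (h1 : tsum x.1 = tsum y.1) (h2 : tsum x.2 = tsum y.2) (h : Eqv n (W n x) (W n y)) : x = y := by
  induction m using Nat.strong_induction_on generalizing x y with
  | _ m ih =>
  by_cases q : ∃ i, 1 ≤ i ∧ i ≤ n ∧ 0 < ter n i x
  · obtain ⟨i, i1, i2, i3⟩ := q
    have we1 : 0 < we n i (W n x) := by rw [← (ter_we i1 i2 x).1]; exact i3
    have we2 : 0 < we n i (W n y) := by rw [← h.eps i1 i2]; exact we1
    obtain ⟨x', hx⟩ := eTen_pos hn i2 x i3
    obtain ⟨y', hy⟩ := eTen_pos hn i2 y (by rw [(ter_we i1 i2 y).1]; exact we2)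
    have wx := W_eTen hn i1 i2 x x' hx
    have wy := W_eTen hn i1 i2 y y' hy
    have sx := eTen_some hn i2 x x' hx
    have sy := eTen_some hn i2 y y' hy
    have e := h.e i1 i2 we1
    rw [← wx, ← wy] at e
    have sp := (wE_spec i1 i2 _ we1).2.2.1
    rw [← wx] at sp
    have := ih (W n x').sum (by omega) x' y' rfl (by omega) (by omega) e
    subst this
    exact W_inj (wE_inj i1 i2 _ _ we1 we2 (by rw [← wx, ← wy])) h1
  · push Not at q
    have qx : ∀ i, 1 ≤ i → i ≤ n → ter n i x = 0 := fun i i1 i2 => by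
      have := q i i1 i2; omega
    have qy : ∀ i, 1 ≤ i → i ≤ n → ter n i y = 0 := fun i i1 i2 => by
      rw [(ter_we i1 i2 y).1, ← h.eps i1 i2, ← (ter_we i1 i2 x).1]; exact qx i i1 i2
    obtain ⟨a, c, d, ex, f1, f2⟩ := hw_class hn x qx
    obtain ⟨a', c', d', ey, g1, g2⟩ := hw_class hn y qy
    have t1 := h.phi (i := 1) (by omega) (by omega)
    have t2 := h.phi (i := 2) (by omega) (by omega)
    rw [← (ter_we (by omega) (by omega) x).2, ← (ter_we (by omega) (by omega) y).2, ex, ey] at t1 t2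
    rw [(hw_tpr hn _ _ _ _).1, (hw_tpr hn _ _ _ _).1] at t1
    rw [(hw_tpr hn _ _ _ _).2, (hw_tpr hn _ _ _ _).2] at t2
    rw [ex, ey, h1]
    have : a = a' := by omega
    have : d = d' := by omega
    subst t2; subst a'; subst d'; rfl

theorem mem_prod {n l k : ℕ} (u : T2 n) : u ∈ BA n l ×ˢ BA n k ↔ tsum u.1 = l ∧ tsum u.2 = k :=
  Iff.rfl

theorem iso_ter {n l k : ℕ} (hn : 2 ≤ n) {ι : T2 n → T2 n} (hι : IsIsoA n l k ι) {i : ℕ}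
    (hi : i ≤ n) (m : ℕ) (u : T2 n) (hm : ter n i u = m) (hu : u ∈ BA n l ×ˢ BA n k) :
    ter n i (ι u) = ter n i u := by
  induction m generalizing u with
  | zero =>
    have h := (hι.2 u hu i hi).1
    cases h' : eTenA n i u with
    | none =>
      rw [h'] at h
      rw [hm, eTen_none hn hi _ h.symm]
    | some v => have := (eTen_some hn hi u v h').1; omega
  | succ m ih =>
    have h := (hι.2 u hu i hi).1
    cases h' : eTenA n i u with
    | none => have := eTen_none hn hi u h'; omega
    | some v =>
      rw [h'] at h
      have a := eTen_some hn hi u v h'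
      have b := eTen_some hn hi _ _ h.symm
      have := ih v (by omega) ((mem_prod v).2 ⟨by have := ((mem_prod u).1 hu).1; omega, by have := ((mem_prod u).1 hu).2; omega⟩)
      omega

theorem iso_tpr {n l k : ℕ} (hn : 2 ≤ n) {ι : T2 n → T2 n} (hι : IsIsoA n l k ι) {i : ℕ}
    (hi : i ≤ n) (m : ℕ) (u : T2 n) (hm : tpr n i u = m) (hu : u ∈ BA n l ×ˢ BA n k) :
    tpr n i (ι u) = tpr n i u := by
  induction m generalizing u with
  | zero =>
    have h := (hι.2 u hu i hi).2
    cases h' : fTenA n i u with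
    | none =>
      rw [h'] at h
      rw [hm, fTen_none hn hi _ h.symm]
    | some v => have := (fTen_some hn hi u v h').1; omega
  | succ m ih =>
    have h := (hι.2 u hu i hi).2
    cases h' : fTenA n i u with
    | none => have := fTen_none hn hi u h'; omega
    | some v =>
      rw [h'] at h
      have a := fTen_some hn hi u v h'
      have b := fTen_some hn hi _ _ h.symm
      have := ih v (by omega) ((mem_prod v).2 ⟨by have := ((mem_prod u).1 hu).1; omega, by have := ((mem_prod u).1 hu).2; omega⟩)
      omega

theorem iso_eqv {n l k : ℕ} (hn : 2 ≤ n) {ι : T2 n → T2 n} (hι : IsIsoA n l k ι)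
    (u : T2 n) (hu : u ∈ BA n l ×ˢ BA n k) : Eqv n (W n u) (W n (ι u)) := by
  intro d
  induction d generalizing u with
  | zero => trivial
  | succ d ih =>
    intro i i1 i2
    refine ⟨?_, ?_, fun h0 => ?_⟩
    · rw [← (ter_we i1 i2 u).1, ← (ter_we i1 i2 _).1, iso_ter hn hι i2 _ u rfl hu]
    · rw [← (ter_we i1 i2 u).2, ← (ter_we i1 i2 _).2, iso_tpr hn hι i2 _ u rfl hu]
    · rw [← (ter_we i1 i2 u).1] at h0
      obtain ⟨v, hv⟩ := eTen_pos hn i2 u h0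
      have h := (hι.2 u hu i i2).1
      rw [hv] at h
      rw [← W_eTen hn i1 i2 u v hv, ← W_eTen hn i1 i2 _ _ h.symm]
      have a := eTen_some hn i2 u v hv
      exact ih v ((mem_prod v).2 ⟨by have := ((mem_prod u).1 hu).1; omega, by have := ((mem_prod u).1 hu).2; omega⟩)

theorem iso_eq {n l k : ℕ} (hn : 2 ≤ n) {ι : T2 n → T2 n} (hι : IsIsoA n l k ι)
    (u x : T2 n) (hu : u ∈ BA n l ×ˢ BA n k) (hx : x ∈ BA n k ×ˢ BA n l)
    (h : Eqv n (W n u) (W n x)) : ι u = x := by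
  have h1 := hι.1.mapsTo hu
  have a := (mem_prod _).1 h1
  have b := (mem_prod _).1 hx
  exact uniq hn _ _ _ rfl (by omega) (by omega) ((iso_eqv hn hι u hu).symm.trans h)

theorem pre_rep {R : ℕ → ℕ → Prop} (N z : ℕ) (w : List ℕ) (hw : w.Pairwise R)
    (hN : ∀ x ∈ w, R x N → x = N) (hz : z ≤ w.count N) :
    w = List.replicate z N ++ w.drop z := by
  induction z generalizing w with
  | zero => simp
  | succ z ih =>
    cases w with
    | nil => simp at hz
    | cons a w =>
      have ha : a = N := by
        by_contra hne
        have : 0 < w.count N := by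
          rw [List.count_cons_of_ne hne] at hz; omega
        have := List.count_pos_iff.1 this
        exact hne (hN a (by simp) ((List.pairwise_cons.1 hw).1 N this))
      subst ha
      rw [List.count_cons_self] at hz
      have := ih w (List.pairwise_cons.1 hw).2 (fun x hx => hN x (by simp [hx])) (by omega)
      rw [List.replicate_succ, List.drop_succ_cons, List.cons_append, ← this]

theorem pre_one {n z : ℕ} (hn : 1 ≤ n) (b : Tup n) (hz : z ≤ xc b 1) :
    coreWord n b = List.replicate z 1 ++ (coreWord n b).drop z := by
  refine pre_rep 1 z _ (cw_sorted n b) ?_ ?_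
  · intro x hx h; have := cw_range hx; omega
  · rw [cw_x b (by omega) (by omega)]; exact hz

theorem suf_bar {n z : ℕ} (hn : 1 ≤ n) (b : Tup n) (hz : z ≤ xbc b 1) :
    coreWord n b = (coreWord n b).take (tsum b - z) ++ List.replicate z (2 * n) := by
  have h := pre_rep (R := fun a b => b ≤ a) (2 * n) z (coreWord n b).reverse ?_ ?_ ?_
  · have h2 := congrArg List.reverse h
    rw [List.reverse_reverse, List.reverse_append, List.reverse_replicate, List.drop_reverse,
      List.reverse_reverse, cw_length] at h2
    exact h2
  · rw [List.pairwise_reverse]; exact cw_sorted n b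
  · intro x hx h; rw [List.mem_reverse] at hx; have := cw_range hx; omega
  · have := cw_xb b (j := 1) (by omega) (by omega)
    rw [List.count_reverse]
    rw [show 2 * n + 1 - 1 = 2 * n by omega] at this
    omega

theorem rule_A {n l k : ℕ} (hn : 2 ≤ n)
    (b1 b2 : Tup n) (hb1 : b1 ∈ BA n l) (hb2 : b2 ∈ BA n k)
    (z l' k' m : ℕ)
    (hz : z = min (xc b1 1) (xbc b2 1))
    (hl' : l' = l - z) (hk' : k' = k - z)
    (P : List (List ℕ))
    (hP : P = insertWord n ((rowWordA n b2).take (k - z))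
                (rowCols ((rowWordA n b1).drop z)))
    (hm : m = numTwoCols P)
    (Q1 : List (List ℕ) × List ℕ) (hQ1 : Q1 = rbIter (rbFirst n) (l' - m) P)
    (Q2 : List (List ℕ) × List ℕ) (hQ2 : Q2 = rbIter (rbSecond n) m Q1.1)
    (b1' b2' : Tup n) (hb1' : b1' ∈ BA n l) (hb2' : b2' ∈ BA n k)
    (hw1 : rowWordA n b1' = (Q1.2 ++ Q2.2) ++ List.replicate z (bar n 1))
    (hw2 : rowWordA n b2' = List.replicate z 1 ++ colsWord Q2.1) :
    KN n P ∧ Eqv n (W n (b1, b2)) (wd P) ∧ Eqv n (wd P) (W n (b2', b1')) := by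
  have hb1 : tsum b1 = l := hb1
  have hb2 : tsum b2 = k := hb2
  unfold rowWordA at *
  have e1 := pre_one (z := z) (by omega) b1 (by omega)
  have e2 := suf_bar (z := z) (by omega) b2 (by omega)
  rw [hb2] at e2
  set w := (coreWord n b1).drop z with hw
  set u := (coreWord n b2).take (k - z) with hu
  have hwl : w.length = l' := by rw [hw, List.length_drop, cw_length, hb1, hl']
  have hx : xc b1 1 = z + w.count 1 := by
    rw [← cw_x b1 (by omega) (by omega), e1, List.count_append, List.count_replicate_self]
  have hxb : xbc b2 1 = u.count (2 * n) + z := by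
    rw [← cw_xb b2 (by omega) (by omega), e2, show 2 * n + 1 - 1 = 2 * n by omega,
      List.count_append, List.count_replicate_self]
  obtain ⟨r1, r2, r3⟩ := rule_main hn w u ((cw_sorted n b1).drop) 
    (fun x hx => cw_range (List.mem_of_mem_drop hx)) ((cw_sorted n b2).take)
    (fun x hx => cw_range (List.mem_of_mem_take hx)) (by
      intro h1 h2
      have := List.count_pos_iff.2 h1
      have := List.count_pos_iff.2 h2
      omega) P hP Q1 Q2 (by rw [hwl, ← hm]; exact hQ1) (by rw [← hm]; exact hQ2)
  refine ⟨r1, ?_, ?_⟩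
  · refine Eqv.trans ?_ r2
    have := Eqv.pairs hn z w.reverse u.reverse
    unfold W rw'
    simp only
    rw [e1, e2]
    simpa using this
  · refine r3.trans ?_
    have hbar : bar n 1 = 2 * n := by unfold bar; omega
    have := Eqv.pairs hn z (colsWord Q2.1).reverse (Q1.2 ++ Q2.2).reverse
    unfold W rw'
    simp only
    rw [hw1, hw2, hbar]
    simpa using this.symm

theorem col_E {n i : ℕ} (hn : 2 ≤ n) (hi : 1 ≤ i) (hin : i ≤ n) {C : List ℕ} (hC : col n C)
    (h0 : 0 < we n i C) : col n (wE n i C) := by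
  rcases col_cases hC with ⟨p, rfl, c1, c2⟩ | ⟨p, q, rfl, c1, c2, c3, c4⟩
  · rcases let_cases hi hin p with H0 | H0 | H0 | H0 | H0 <;> obtain ⟨e0, f0, H0⟩ := H0 <;>
    simp [we, wE, e0, f0] at h0 ⊢ <;> simp only [col] <;> omega
  · rcases let_cases hi hin p with H0 | H0 | H0 | H0 | H0 <;> obtain ⟨e0, f0, H0⟩ := H0 <;>
    rcases let_cases hi hin q with H1 | H1 | H1 | H1 | H1 <;> obtain ⟨e1, f1, H1⟩ := H1 <;>
    first
    | omega
    | (simp [we, wE, e0, f0, e1, f1] at h0 ⊢ <;> simp only [col, Col2] <;> omega)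

theorem adj_cases {n : ℕ} {C D : List ℕ} (h : adj n C D) :
    (∃ p p', C = [p] ∧ D = [p'] ∧ p ≤ p') ∨ (∃ p q p', C = [p, q] ∧ D = [p'] ∧ p ≤ p') ∨
    (∃ p q p' q', C = [p, q] ∧ D = [p', q'] ∧ p ≤ p' ∧ q ≤ q' ∧ ¬ (p = p' ∧ p' + q' = 2 * n + 1) ∧
      ¬ (p + q = 2 * n + 1 ∧ q = q')) := by
  match C, D, h with
  | [p], [p'], h => exact Or.inl ⟨p, p', rfl, rfl, h⟩
  | [p, q], [p'], h => exact Or.inr (Or.inl ⟨p, q, p', rfl, rfl, h⟩)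
  | [p, q], [p', q'], h => exact Or.inr (Or.inr ⟨p, q, p', q', rfl, rfl, h⟩)

theorem we_two (n i p q : ℕ) : we n i [p, q] = el n i p + (el n i q - pl n i p) := by
  simp [we]
theorem wp_two (n i p q : ℕ) : wp n i [p, q] = pl n i q + (pl n i p - el n i q) := by
  simp [wp, we]
theorem wE_two {n i p q : ℕ} (h : 0 < we n i [p, q]) :
    (el n i q ≤ pl n i p ∧ el n i p = 1 ∧ wE n i [p, q] = [p - 1, q]) ∨
    (pl n i p < el n i q ∧ el n i q = 1 ∧ wE n i [p, q] = [p, q - 1]) := by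
  rw [we_two] at h
  have := el_le n i p
  have := el_le n i q
  have e : we n i [q] = el n i q := by simp [we]
  by_cases k : el n i q ≤ pl n i p
  · left
    refine ⟨k, by omega, ?_⟩
    show (if we n i [q] ≤ pl n i p then _ else _) = _
    rw [if_pos (by omega)]
  · right
    refine ⟨by omega, by omega, ?_⟩
    show (if we n i [q] ≤ pl n i p then _ else p :: wE n i [q]) = _
    rw [if_neg (by omega)]
    simp [wE, we]
theorem we_sgl (n i p : ℕ) : we n i [p] = el n i p := by simp [we]
theorem wp_sgl (n i p : ℕ) : wp n i [p] = pl n i p := by simp [wp, we]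
theorem wE_sgl (n i p : ℕ) : wE n i [p] = [p - 1] := by simp [wE, we]

theorem adj_E {n i : ℕ} (hn : 2 ≤ n) (hi : 1 ≤ i) (hin : i ≤ n) {C D : List ℕ} (hC : col n C)
    (hD : col n D) (h : adj n C D) :
    (wp n i D < we n i C → adj n (wE n i C) D) ∧
    (we n i C ≤ wp n i D → 0 < we n i D → adj n C (wE n i D)) := by
  rcases adj_cases h with ⟨p, p', rfl, rfl, h1⟩ | ⟨p, q, p', rfl, rfl, h1⟩ |
    ⟨p, q, p', q', rfl, rfl, h1, h2, h3, h4⟩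
  · rw [wE_sgl, wE_sgl, we_sgl, we_sgl, wp_sgl]
    refine ⟨fun g => by simp only [adj]; omega, fun g1 g2 => ?_⟩
    have := el_le n i p'
    have f := pl_of_el hi hin (show el n i p' = 1 by omega)
    have : p ≠ p' := by rintro rfl; omega
    simp only [adj]; omega
  · simp only [col, Col2] at hC
    refine ⟨fun g => ?_, fun g1 g2 => ?_⟩
    · rcases wE_two (n := n) (i := i) (p := p) (q := q) (by omega) with ⟨g1, g2, g3⟩ | ⟨g1, g2, g3⟩
      · rw [g3]; simp only [adj]; omega
      · rw [g3]; simp only [adj]; omega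
    · rw [wE_sgl]
      rw [we_two, wp_sgl] at g1
      rw [we_sgl] at g2
      have := el_le n i p'
      have f := pl_of_el hi hin (show el n i p' = 1 by omega)
      have : p ≠ p' := by rintro rfl; omega
      simp only [adj]; omega
  · simp only [col, Col2] at hC hD
    refine ⟨fun g => ?_, fun g1 g2 => ?_⟩
    · rcases wE_two (n := n) (i := i) (p := p) (q := q) (by omega) with ⟨g1, g2, g3⟩ | ⟨g1, g2, g3⟩
      · rw [g3]; simp only [adj]
        have f := pl_of_el hi hin g2
        have q0 : el n i q = 0 := by omega
        unfold el at q0 g2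
        split_ifs at q0 g2
        refine ⟨by omega, h2, by omega, by omega⟩
      · rw [g3]; simp only [adj]
        refine ⟨h1, by omega, h3, by omega⟩
    · rw [wp_two, we_two] at g1
      rcases wE_two g2 with ⟨k1, k2, k3⟩ | ⟨k1, k2, k3⟩
      · rw [k3]; simp only [adj]
        have f := pl_of_el hi hin k2
        have q0 : el n i q' = 0 := by omega
        have hp : p ≠ p' := by
          rintro rfl
          have e : pl n i q' = 1 := by have := pl_le n i q'; omega
          unfold pl at e
          unfold el at k2
          split_ifs at e k2
          omega
        unfold el at q0 k2
        split_ifs at q0 k2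
        refine ⟨by omega, h2, by omega, h4⟩
      · rw [k3]; simp only [adj]
        have f := pl_of_el hi hin k2
        have p0 : pl n i p' = 0 := by omega
        have c0 : el n i p = 0 ∧ el n i q ≤ pl n i p := by omega
        have hq : q ≠ q' := by
          rintro rfl
          have e : pl n i p = 1 := by have := pl_le n i p; omega
          unfold pl at e p0
          unfold el at k2
          split_ifs at e k2 p0
          omega
        have c1 := c0.1
        unfold el at c1 k2
        split_ifs at c1 k2
        refine ⟨h1, by omega, by omega, by omega⟩

theorem n2_len {C C' : List ℕ} (T : List (List ℕ)) (h : C'.length = C.length) :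
    numTwoCols (C' :: T) = numTwoCols (C :: T) := by
  unfold numTwoCols
  simp [List.filter_cons, h]
  split_ifs <;> rfl

theorem KN_E {n i : ℕ} (hn : 2 ≤ n) (hi : 1 ≤ i) (hin : i ≤ n) (T : List (List ℕ)) (hT : KN n T)
    (h0 : 0 < we n i (wd T)) : ∃ T', KN n T' ∧ wd T' = wE n i (wd T) ∧
      numTwoCols T' = numTwoCols T ∧
      ∀ C, col n C → hadj n C T → we n i C ≤ wp n i (wd T) → hadj n C T' := by
  induction T with
  | nil => simp [wd, we] at h0
  | cons D S ih =>
    obtain ⟨k1, k2, k3⟩ := hT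
    have a := we_app n i (wd S) D
    rw [show wd (D :: S) = wd S ++ D from rfl] at h0 ⊢
    rw [wE_app _ _ _ _ h0]
    by_cases q : we n i D ≤ wp n i (wd S)
    · rw [if_pos q]
      obtain ⟨T', t1, t2, t3, t4⟩ := ih k3 (by omega)
      refine ⟨D :: T', ⟨k1, t4 D k1 k2 q, t1⟩, ?_, ?_, fun C _ h _ => h⟩
      · rw [show wd (D :: T') = wd T' ++ D from rfl, t2]
      · have x : ∀ T : List (List ℕ), numTwoCols (D :: T) = numTwoCols [D] + numTwoCols T :=
          fun T => n2_app [D] T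
        rw [x T', x S, t3]
    · rw [if_neg q]
      have sp := wE_spec hi hin D (by omega)
      refine ⟨wE n i D :: S, ⟨col_E hn hi hin k1 (by omega), ?_, k3⟩, rfl, n2_len S sp.2.2.2, ?_⟩
      · cases S with
        | nil => trivial
        | cons E S =>
          refine (adj_E hn hi hin k1 k3.1 k2).1 ?_
          have := (we_app n i (wd S) E).2
          rw [← show wd (E :: S) = wd S ++ E from rfl] at this
          omega
      · intro C hC h1 h2
        exact (adj_E hn hi hin hC k1 h1).2 (by omega) (by omega)

def Yam (T : List (List ℕ)) : Prop := ∀ C ∈ T, C = [1] ∨ C = [1, 2]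

theorem yam_col {n i : ℕ} (hn : 2 ≤ n) (h2 : 2 ≤ i) (hin : i ≤ n) :
    we n i [1] = 0 ∧ wp n i [1] = 0 ∧ we n i [1, 2] = 0 ∧
      wp n i [1, 2] = if i = 2 then 1 else 0 := by
  have a1 : el n i 1 = 0 := by unfold el; rw [if_neg (by omega)]
  have a2 : el n i 2 = 0 := by unfold el; rw [if_neg (by omega)]
  have a3 : pl n i 1 = 0 := by unfold pl; rw [if_neg (by omega)]
  have a4 : pl n i 2 = if i = 2 then 1 else 0 := by unfold pl; split_ifs <;> omega
  rw [we_sgl, wp_sgl, we_two, wp_two, a1, a2, a3, a4]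
  simp

theorem yam_wp {n i : ℕ} (hn : 2 ≤ n) (h2 : 2 ≤ i) (hin : i ≤ n) (T : List (List ℕ)) (h : Yam T) :
    wp n i (wd T) = if i = 2 then numTwoCols T else 0 := by
  obtain ⟨a1, a2, a3, a4⟩ := yam_col hn h2 hin
  induction T with
  | nil => rw [n2_nil]; simp [wd, wp]
  | cons C T ih =>
    have ih := ih (fun D hD => h D (by simp [hD]))
    rw [show wd (C :: T) = wd T ++ C from rfl, (we_app _ _ _ _).2, ih]
    rcases h C (by simp) with rfl | rfl
    · rw [a1, a2, n2_one]; omega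
    · rw [a3, a4, n2_two]; split_ifs <;> omega

theorem hw_yam {n : ℕ} (hn : 2 ≤ n) (T : List (List ℕ)) (hT : KN n T)
    (h : ∀ i, 1 ≤ i → i ≤ n → we n i (wd T) = 0) : Yam T := by
  induction T with
  | nil => intro C hC; simp at hC
  | cons C T ih =>
    obtain ⟨k1, k2, k3⟩ := hT
    have hh : ∀ i, 1 ≤ i → i ≤ n → we n i (wd T) = 0 ∧ we n i C ≤ wp n i (wd T) := by
      intro i i1 i2
      have := h i i1 i2
      rw [show wd (C :: T) = wd T ++ C from rfl, (we_app _ _ _ _).1] at this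
      omega
    have ihT := ih k3 (fun i i1 i2 => (hh i i1 i2).1)
    suffices hC : C = [1] ∨ C = [1, 2] by
      intro D hD
      rcases List.mem_cons.1 hD with rfl | hD
      · exact hC
      · exact ihT D hD
    have hone : ∀ p, 1 ≤ p → p ≤ 2 * n → (∀ i, 1 ≤ i → i ≤ n → el n i p = 0) → p = 1 := by
      intro p p1 p2 hp
      by_contra hne
      by_cases q : p ≤ n + 1
      · have := hp (p - 1) (by omega) (by omega)
        unfold el at this; split_ifs at this; omega
      · have := hp (2 * n + 1 - p) (by omega) (by omega)
        unfold el at this; split_ifs at this; omega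
    rcases col_cases k1 with ⟨p, rfl, c1, c2⟩ | ⟨p, q, rfl, c1, c2, c3, c4⟩
    · left
      have : p = 1 := by
        cases T with
        | nil =>
          refine hone p c1 c2 (fun i i1 i2 => ?_)
          have := (hh i i1 i2).2
          rw [we_sgl] at this
          simpa [wd, wp] using this
        | cons D S =>
          rcases ihT D (by simp) with rfl | rfl
          · simp only [hadj, adj] at k2; omega
          · simp only [hadj, adj] at k2
      rw [this]
    · right
      have hp : p = 1 := by
        cases T with
        | nil =>
          refine hone p c1 (by omega) (fun i i1 i2 => ?_)
          have := (hh i i1 i2).2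
          rw [we_two] at this
          simp [wd, wp] at this
          exact this.1
        | cons D S =>
          rcases ihT D (by simp) with rfl | rfl
          · simp only [hadj, adj] at k2; omega
          · simp only [hadj, adj] at k2; omega
      subst hp
      have key : (∀ i, 2 ≤ i → i ≤ n → wp n i (wd T) = 0) → q = 2 := by
        intro hw
        by_contra hne
        have z : ∀ i, 2 ≤ i → i ≤ n → el n i q = 0 := by
          intro i i1 i2
          have := (hh i (by omega) i2).2
          rw [hw i i1 i2, we_two] at this
          have a3 : pl n i 1 = 0 := by unfold pl; rw [if_neg (by omega)]
          omega
        by_cases r : q ≤ n + 1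
        · have := z (q - 1) (by omega) (by omega)
          unfold el at this; split_ifs at this; omega
        · have := z (2 * n + 1 - q) (by omega) (by omega)
          unfold el at this; split_ifs at this; omega
      have : q = 2 := by
        cases T with
        | nil => exact key (fun i _ _ => rfl)
        | cons D S =>
          rcases ihT D (by simp) with rfl | rfl
          · refine key (fun i i1 i2 => ?_)
            rw [yam_wp hn i1 i2 _ ihT, n2_one, n2_sgl k3]; simp
          · simp only [hadj, adj] at k2; omega
      rw [this]

/-- the number of `(1, 2n)` pairs -/
def zz {n : ℕ} (u : T2 n) : ℕ := min (xc u.1 1) (xbc u.2 1)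

theorem eA_first {n i : ℕ} (hn : 2 ≤ n) (h1 : 1 ≤ i) (hin : i ≤ n) (b b' : Tup n)
    (h : eA n i b = some b') :
    (2 ≤ i ∧ xc b' 1 = xc b 1 ∧ xbc b' 1 = xbc b 1) ∨
    (i = 1 ∧ xbc b 2 < xc b 2 ∧ xc b' 1 = xc b 1 + 1 ∧ xbc b' 1 = xbc b 1) ∨
    (i = 1 ∧ xc b 2 ≤ xbc b 2 ∧ xc b' 1 = xc b 1 ∧ xbc b' 1 + 1 = xbc b 1) := by
  rcases eA_char hn hin b with ⟨k1, k2⟩ | ⟨b'', k1, k2, k3⟩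
  · rw [h] at k1; simp at k1
  rw [h] at k1
  obtain rfl : b' = b'' := by simpa using k1
  rcases k3 with ⟨e0, _⟩ | ⟨e0, _⟩ | ⟨e0, e1, e2, e3⟩ | ⟨e0, e1, e2, e3⟩ | ⟨e0, e1, e2, e4, e3⟩
  · omega
  · omega
  · left
    have := e3 1 (by omega) (by omega)
    rw [if_neg (by omega), if_neg (by omega)] at this
    exact ⟨by omega, this.1, this.2⟩
  · have := e3 1 (by omega) (by omega)
    rw [if_neg (by omega)] at this
    by_cases q : i = 1
    · subst q; right; left; simp at this; exact ⟨rfl, e2, this.1, this.2⟩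
    · left; rw [if_neg (by omega)] at this; exact ⟨by omega, this.1, this.2⟩
  · have := e3 1 (by omega) (by omega)
    by_cases q : i = 1
    · subst q; right; right; simp at this; exact ⟨rfl, by omega, this.1, by omega⟩
    · left; rw [if_neg (by omega), if_neg (by omega)] at this; exact ⟨by omega, this.1, this.2⟩

theorem zz_inv {n i : ℕ} (hn : 2 ≤ n) (h1 : 1 ≤ i) (hin : i ≤ n) (u v : T2 n)
    (h : eTenA n i u = some v) : zz v = zz u := by
  obtain ⟨-, -, -, -, k⟩ := eTen_some hn hin u v h
  unfold zz
  have hr : i = 1 → ∀ b : Tup n, er n i b = xbc b 1 + (xc b 2 - xbc b 2) ∧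
      pr n i b = xc b 1 + (xbc b 2 - xc b 2) := by
    rintro rfl b
    unfold er pr
    rw [if_neg (show ¬ 1 = 0 by omega), if_neg (show ¬ 1 = 0 by omega),
      if_neg (show ¬ 1 = n by omega), if_neg (show ¬ 1 = n by omega)]
    exact ⟨rfl, rfl⟩
  rcases k with ⟨c1, c2, c3⟩ | ⟨c1, c2, c3⟩
  · rw [c3]
    rcases eA_first hn h1 hin _ _ c2 with ⟨d1, d2, d3⟩ | ⟨d1, d2, d3, d4⟩ | ⟨d1, d2, d3, d4⟩
    · rw [d2]
    · have := hr d1 u.1; have := hr d1 u.2; omega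
    · rw [d3]
  · rw [c3]
    rcases eA_first hn h1 hin _ _ c2 with ⟨d1, d2, d3⟩ | ⟨d1, d2, d3, d4⟩ | ⟨d1, d2, d3, d4⟩
    · rw [d3]
    · rw [d4]
    · have := hr d1 u.1; have := hr d1 u.2; omega

theorem raise {n l k : ℕ} (hn : 2 ≤ n) {ι : T2 n → T2 n} {H : T2 n → ℤ}
    (hH : IsEnergyA n l k ι H) (m : ℕ) (u : T2 n) (hm : (W n u).sum = m)
    (hu : u ∈ BA n l ×ˢ BA n k) (T : List (List ℕ)) (hT : KN n T) (hE : Eqv n (W n u) (wd T)) :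
    ∃ a c d, a + c + d = k ∧ c + d ≤ l ∧ H u = H (hwv n l a c d) ∧ d = zz u ∧
      c = numTwoCols T := by
  induction m using Nat.strong_induction_on generalizing u T with
  | _ m ih =>
  have hu' := (mem_prod u).1 hu
  by_cases q : ∃ i, 1 ≤ i ∧ i ≤ n ∧ 0 < ter n i u
  · obtain ⟨i, i1, i2, i3⟩ := q
    have we1 : 0 < we n i (W n u) := by rw [← (ter_we i1 i2 u).1]; exact i3
    obtain ⟨v, hv⟩ := eTen_pos hn i2 u i3
    have wv := W_eTen hn i1 i2 u v hv
    have sv := eTen_some hn i2 u v hv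
    obtain ⟨T', t1, t2, t3, -⟩ := KN_E hn i1 i2 T hT (by rw [← hE.eps i1 i2]; exact we1)
    have e := hE.e i1 i2 we1
    rw [← wv, ← t2] at e
    have sp := (wE_spec i1 i2 _ we1).2.2.1
    rw [← wv] at sp
    obtain ⟨a, c, d, r1, r2, r3, r4, r5⟩ := ih (W n v).sum (by omega) v rfl
      ((mem_prod v).2 ⟨by omega, by omega⟩) T' t1 e
    have hHv := hH.1 u hu i i2 v hv
    rw [if_neg (show ¬ i = 0 by omega)] at hHv
    rw [zz_inv hn i1 i2 u v hv] at r4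
    exact ⟨a, c, d, r1, r2, by rw [← r3, hHv]; simp, r4, by rw [r5, t3]⟩
  · push Not at q
    have qx : ∀ i, 1 ≤ i → i ≤ n → ter n i u = 0 := fun i i1 i2 => by
      have := q i i1 i2; omega
    obtain ⟨a, c, d, ex, f1, f2⟩ := hw_class hn u qx
    rw [hu'.1] at ex f2
    rw [hu'.2] at f1
    refine ⟨a, c, d, f1, f2, by rw [← ex], ?_, ?_⟩
    · rw [ex]; unfold zz hwv; simp only; rw [tri_x1 hn, tri_b1 hn]; omega
    · have y := hw_yam hn T hT (fun i i1 i2 => by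
        rw [← hE.eps i1 i2, ← (ter_we i1 i2 u).1]; exact qx i i1 i2)
      have t2 := hE.phi (i := 2) (by omega) (by omega)
      rw [← (ter_we (by omega) (by omega) u).2, ex, (hw_tpr hn _ _ _ _).2,
        yam_wp hn (by omega) (by omega) T y, if_pos rfl] at t2
      exact t2

theorem KN_rep {n p : ℕ} (h1 : 1 ≤ p) (h2 : p ≤ 2 * n) (m : ℕ) :
    KN n (List.replicate m [p]) ∧ wd (List.replicate m [p]) = List.replicate m p ∧
      numTwoCols (List.replicate m [p]) = 0 ∧
      ∀ C, adj n C [p] → hadj n C (List.replicate m [p]) := by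
  induction m with
  | zero => exact ⟨trivial, rfl, rfl, fun _ _ => trivial⟩
  | succ m ih =>
    obtain ⟨i1, i2, i3, i4⟩ := ih
    rw [List.replicate_succ]
    refine ⟨⟨⟨h1, h2⟩, i4 _ ?_, i1⟩, ?_, ?_, fun C h => h⟩
    · simp [adj]
    · rw [show wd ([p] :: List.replicate m [p]) = wd (List.replicate m [p]) ++ [p] from rfl, i2,
        ← List.replicate_succ']
    · rw [n2_one, i3]

/-- the word of an element with only `x_1 = a`, `x̄_2 = e`, `x̄_1 = d` nonzero -/
theorem rw_spec {n : ℕ} (hn : 2 ≤ n) (b : Tup n) (a e d : ℕ)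
    (h : ∀ j, 1 ≤ j → j ≤ n → xc b j = (if j = 1 then a else 0) ∧
      xbc b j = (if j = 1 then d else if j = 2 then e else 0)) :
    rw' n b = List.replicate d (2 * n) ++ (List.replicate e (2 * n - 1) ++ List.replicate a 1) := by
  refine Dec.ext (rw_dec n b) ⟨?_, ?_⟩ ?_
  · simp only [List.pairwise_append, List.pairwise_replicate, List.mem_append, List.mem_replicate]
    refine ⟨by simp, ⟨by simp, by simp, ?_⟩, ?_⟩
    · rintro x ⟨-, rfl⟩ y ⟨-, rfl⟩; omega
    · rintro x ⟨-, rfl⟩ y (⟨-, rfl⟩ | ⟨-, rfl⟩) <;> omega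
  · intro x hx
    simp only [List.mem_append, List.mem_replicate] at hx
    omega
  · intro j j1 j2
    simp only [List.count_append, List.count_replicate, beq_iff_eq]
    by_cases q : j ≤ n
    · rw [rw_x b j1 q, (h j j1 q).1]
      rw [if_neg (show ¬ 2 * n = j by omega), if_neg (show ¬ 2 * n - 1 = j by omega)]
      split_ifs <;> omega
    · have := rw_xb b (j := 2 * n + 1 - j) (by omega) (by omega)
      rw [show 2 * n + 1 - (2 * n + 1 - j) = j by omega] at this
      rw [this, (h _ (by omega) (by omega)).2, if_neg (show ¬ 1 = j by omega)]
      by_cases r : j = 2 * n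
      · rw [if_pos (by omega), if_pos (by omega), if_neg (by omega)]; omega
      · rw [if_neg (by omega), if_neg (show ¬ 2 * n = j by omega)]
        by_cases s : j = 2 * n - 1
        · rw [if_pos (by omega), if_pos (by omega)]; omega
        · rw [if_neg (by omega), if_neg (by omega)]

theorem shift_ones {n : ℕ} (hn : 2 ≤ n) (m : ℕ) (u : List ℕ) :
    Eqv n (u ++ (1 :: (2 * n - 1) :: List.replicate m 1))
      (u ++ (List.replicate m 1 ++ [1, 2 * n - 1])) := by
  induction m generalizing u with
  | zero => exact Eqv.refl _
  | succ m ih =>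
    have h : Eqv n [1, 2 * n - 1, 1] [1, 1, 2 * n - 1] :=
      Ins2.eqv hn ⟨by omega, by omega, by omega, by omega⟩ (le_refl 1)
        (Or.inr (Or.inr (Or.inl ⟨by omega, by omega, rfl, rfl, rfl⟩)))
    have h2 := ((Eqv.refl u).app (h.app (Eqv.refl (List.replicate m 1))))
    rw [List.replicate_succ]
    have h3 := ih (u ++ [1])
    simp only [List.append_assoc, List.cons_append, List.nil_append] at h2 h3 ⊢
    exact h2.trans h3

theorem iso_hw {n l k : ℕ} (hn : 2 ≤ n) {ι : T2 n → T2 n} (hι : IsIsoA n l k ι) (a c d : ℕ)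
    (h1 : a + c + d = k) (h2 : c + d ≤ l) (hu : hwv n l a c d ∈ BA n l ×ˢ BA n k)
    (ht : ∀ i, 1 ≤ i → i ≤ n → ter n i (hwv n l a c d) = 0) :
    ι (hwv n l a c d) = hwv n k (l - c - d) c d := by
  have hx := (mem_prod _).1 (hι.1.mapsTo hu)
  obtain ⟨a', c', d', e, f1, f2⟩ := hw_class hn (ι (hwv n l a c d))
    (fun i i1 i2 => by rw [iso_ter hn hι i2 _ _ rfl hu]; exact ht i i1 i2)
  rw [hx.1] at e f2
  rw [hx.2] at f1
  have t1 := iso_tpr hn hι (i := 1) (by omega) _ _ rfl hu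
  have t2 := iso_tpr hn hι (i := 2) (by omega) _ _ rfl hu
  rw [e, (hw_tpr hn _ _ _ _).1, (hw_tpr hn _ _ _ _).1] at t1
  rw [e, (hw_tpr hn _ _ _ _).2, (hw_tpr hn _ _ _ _).2] at t2
  rw [e]
  subst t2
  obtain rfl : d' = d := by omega
  obtain rfl : a' = l - c' - d' := by omega
  rfl

theorem hw_ter {n l : ℕ} (hn : 2 ≤ n) (a c d : ℕ) (h2 : c + d ≤ l) (i : ℕ) (i1 : 1 ≤ i)
    (i2 : i ≤ n) : ter n i (hwv n l a c d) = 0 := by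
  unfold ter hwv er pr
  simp only
  have x := fun (a c d j : ℕ) (h1 : 1 ≤ j) (h2 : j ≤ n) => (tri_x hn a c d h1 h2).1
  have y := fun (a c d j : ℕ) (h1 : 1 ≤ j) (h2 : j ≤ n) => (tri_x hn a c d h1 h2).2
  simp only [if_neg (show ¬ i = 0 by omega)]
  by_cases q : i = n
  · simp only [if_pos q]
    rw [y _ _ _ n (by omega) (by omega), y _ _ _ n (by omega) (by omega), if_neg (by omega),
      if_neg (by omega)]
    omega
  · simp only [if_neg q]
    rw [y _ _ _ i (by omega) (by omega), y _ _ _ i (by omega) (by omega),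
      y _ _ _ (i + 1) (by omega) (by omega), y _ _ _ (i + 1) (by omega) (by omega),
      x _ _ _ i (by omega) (by omega),
      x _ _ _ (i + 1) (by omega) (by omega), x _ _ _ (i + 1) (by omega) (by omega)]
    by_cases r : i = 1
    · subst r; simp; omega
    · simp [r, show i ≠ 0 by omega]

theorem tri_ep0 {n : ℕ} (hn : 2 ≤ n) (a c d : ℕ) :
    er n 0 (tripleVec n a c d) = a + c ∧ pr n 0 (tripleVec n a c d) = d + (0 - c) := by
  unfold er pr
  simp only [if_true]
  rw [tri_x1 hn, tri_x2 hn, tri_b1 hn, tri_b2 hn]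
  omega

theorem hw_mem {n : ℕ} (hn : 2 ≤ n) {l k a c d : ℕ} (h1 : a + c + d = k) :
    hwv n l a c d ∈ BA n l ×ˢ BA n k := by
  rw [mem_prod]; unfold hwv; simp only; rw [tri_sum hn, tri_sum hn]; omega

/-- one step of `e_0` on a highest weight element -/
theorem hw_e0 {n l k : ℕ} (hn : 2 ≤ n) {ι : T2 n → T2 n} (hι : IsIsoA n l k ι) {H : T2 n → ℤ}
    (hH : IsEnergyA n l k ι H) (a c d : ℕ) (h1 : a + c + d = k) (h2 : c + d ≤ l)
    (h3 : d < l) (h4 : 0 < a + c) : ∃ y, eA n 0 (tripleVec n a c d) = some y ∧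
      H (tripleVec n l 0 0, y) = H (hwv n l a c d) - 1 := by
  have hu := hw_mem hn (l := l) h1
  have he := iso_hw hn hι a c d h1 h2 hu (hw_ter hn a c d h2)
  have e1 := tri_ep0 hn a c d
  have e2 := tri_ep0 hn l 0 0
  have e3 := tri_ep0 hn (l - c - d) c d
  have e4 := tri_ep0 hn k 0 0
  cases hy : eA n 0 (tripleVec n a c d) with
  | none => have := eA_none hn (by omega) _ hy; omega
  | some y =>
    refine ⟨y, rfl, ?_⟩
    have hv : eTenA n 0 (hwv n l a c d) = some (tripleVec n l 0 0, y) := by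
      unfold eTenA hwv
      simp only
      rw [epsA_eq hn (by omega), phiA_eq hn (by omega), if_neg (by omega), hy]
      rfl
    have := hH.1 _ hu 0 (by omega) _ hv
    rw [he] at this
    unfold hwv at this
    simp only [if_true] at this
    rw [epsA_eq hn (by omega), phiA_eq hn (by omega), epsA_eq hn (by omega), phiA_eq hn (by omega),
      if_neg (by omega), if_pos (by omega)] at this
    rw [this]; rfl

theorem H_hw {n l k : ℕ} (hn : 2 ≤ n) {ι : T2 n → T2 n} (hι : IsIsoA n l k ι) {H : T2 n → ℤ}
    (hH : IsEnergyA n l k ι H) (M a c d : ℕ) (h1 : a + c + d = k) (h2 : c + d ≤ l)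
    (hM : M + 2 * d + c = 2 * min l k) : H (hwv n l a c d) = M := by
  induction M generalizing a c d with
  | zero =>
    obtain rfl : c = 0 := by omega
    by_cases q : k ≤ l
    · obtain rfl : a = 0 := by omega
      obtain rfl : d = k := by omega
      have := hH.2
      rw [uvec_tri, barvec_tri] at this
      exact this
    · obtain rfl : d = l := by omega
      obtain ⟨r1, r2, r3, -⟩ := KN_rep (n := n) (p := 2 * n) (by omega) (le_refl _) (k - d)
      have hmem : ((tripleVec n d 0 0, tripleVec n 0 0 k) : T2 n) ∈ BA n d ×ˢ BA n k := by
        rw [mem_prod]; simp only; rw [tri_sum hn, tri_sum hn]; omega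
      obtain ⟨a', c', d', s1, s2, s3, s4, s5⟩ := raise hn hH _ (tripleVec n d 0 0, tripleVec n 0 0 k)
        rfl hmem _ r1 (by
          rw [r2]
          unfold W
          simp only
          rw [rw_spec hn (tripleVec n d 0 0) d 0 0, rw_spec hn (tripleVec n 0 0 k) 0 0 k]
          · have := Eqv.pairs hn d [] (List.replicate (k - d) (2 * n))
            rw [List.replicate_append_replicate,
              show d + (k - d) = k by omega] at this
            simpa using this
          · intro j j1 j2
            rw [(tri_x hn _ _ _ j1 j2).1, (tri_x hn _ _ _ j1 j2).2]; simp
          · intro j j1 j2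
            rw [(tri_x hn _ _ _ j1 j2).1, (tri_x hn _ _ _ j1 j2).2]; simp)
      have hz : zz ((tripleVec n d 0 0, tripleVec n 0 0 k) : T2 n) = d := by
        unfold zz; simp only; rw [tri_x1 hn, tri_b1 hn]; omega
      have h0 := hH.2
      rw [uvec_tri, barvec_tri, s3] at h0
      obtain rfl : c' = 0 := by omega
      obtain rfl : d' = d := by omega
      obtain rfl : a' = a := by omega
      rw [h0]; rfl
  | succ M ih =>
    obtain ⟨y, y1, y2⟩ := hw_e0 hn hι hH a c d h1 h2 (by omega) (by omega)
    rcases eA_char hn (show 0 ≤ n by omega) (tripleVec n a c d) with ⟨k1, k2⟩ | ⟨b'', k1, k2, k3⟩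
    · rw [y1] at k1; simp at k1
    rw [y1] at k1
    obtain rfl : y = b'' := by simpa using k1
    rcases k3 with ⟨e0, e1, e3⟩ | ⟨e0, e1, e2, e3⟩ | ⟨e0, _⟩ | ⟨e0, _⟩ | ⟨e0, _⟩
    · rw [tri_x2 hn, tri_b2 hn] at e1
      have hy : y = tripleVec n a (c - 1) (d + 1) := by
        apply tup_ext
        intro j j1 j2
        have := e3 j j1 j2
        rw [this.1, this.2, (tri_x hn _ _ _ j1 j2).1, (tri_x hn _ _ _ j1 j2).2,
          (tri_x hn _ _ _ j1 j2).1, (tri_x hn _ _ _ j1 j2).2]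
        split_ifs <;> omega
      have := ih a (c - 1) (d + 1) (by omega) (by omega) (by omega)
      rw [hy] at y2
      unfold hwv at this y2 ⊢
      rw [this] at y2
      push_cast
      linarith
    · rw [tri_x2 hn, tri_b2 hn] at e1
      obtain rfl : c = 0 := by omega
      have hyx : ∀ j, 1 ≤ j → j ≤ n → xc y j = (if j = 1 then a - 1 else 0) ∧
          xbc y j = (if j = 1 then d else if j = 2 then 1 else 0) := by
        intro j j1 j2
        have := e3 j j1 j2
        rw [this.1, this.2, (tri_x hn _ _ _ j1 j2).1, (tri_x hn _ _ _ j1 j2).2]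
        split_ifs <;> omega
      obtain ⟨r1, r2, r3, r4⟩ := KN_rep (n := n) (p := 1) (by omega) (by omega) (l - d - 1 + (a - 1))
      have hmem : ((tripleVec n l 0 0, y) : T2 n) ∈ BA n l ×ˢ BA n k := by
        rw [mem_prod]; simp only; rw [tri_sum hn, k2, tri_sum hn]; omega
      have hT : KN n ([1, 2 * n - 1] :: List.replicate (l - d - 1 + (a - 1)) [1]) :=
        ⟨⟨by omega, by omega, by omega, by omega⟩, r4 _ (le_refl 1), r1⟩
      obtain ⟨a', c', d', s1, s2, s3, s4, s5⟩ := raise hn hH _ (tripleVec n l 0 0, y)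
        rfl hmem _ hT (by
          rw [show wd ([1, 2 * n - 1] :: List.replicate (l - d - 1 + (a - 1)) [1]) =
            wd (List.replicate (l - d - 1 + (a - 1)) [1]) ++ [1, 2 * n - 1] from rfl, r2]
          unfold W
          simp only
          rw [rw_spec hn (tripleVec n l 0 0) l 0 0, rw_spec hn y (a - 1) 1 d hyx]
          · have p1 := Eqv.pairs hn d (List.replicate (l - d) 1)
              (List.replicate 1 (2 * n - 1) ++ List.replicate (a - 1) 1)
            rw [← List.append_assoc (List.replicate (l - d) 1), List.replicate_append_replicate,
              show l - d + d = l by omega] at p1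
            have p2 := shift_ones hn (a - 1) (List.replicate (l - d - 1) 1)
            rw [← List.append_assoc, List.replicate_append_replicate] at p2
            have p3 : List.replicate (l - d) 1 ++ (List.replicate 1 (2 * n - 1) ++
                List.replicate (a - 1) 1) = List.replicate (l - d - 1) 1 ++
                (1 :: (2 * n - 1) :: List.replicate (a - 1) 1) := by
              obtain ⟨s, hs⟩ : ∃ s, l - d = s + 1 := ⟨l - d - 1, by omega⟩
              rw [hs, show s + 1 - 1 = s from rfl, List.replicate_succ']
              simp
            rw [p3] at p1
            simpa using p1.trans p2
          · intro j j1 j2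
            rw [(tri_x hn _ _ _ j1 j2).1, (tri_x hn _ _ _ j1 j2).2]; simp)
      have hz : zz ((tripleVec n l 0 0, y) : T2 n) = d := by
        unfold zz; simp only; rw [tri_x1 hn, (hyx 1 (by omega) (by omega)).2, if_pos rfl]; omega
      rw [n2_two, r3] at s5
      have := ih a' c' d' s1 s2 (by omega)
      rw [s3, this] at y2
      push_cast
      linarith
    · omega
    · omega
    · omega


/-- **Theorem 5.1** (main theorem, `A_{2n-1}^{(2)}` case).  Given `b₁ ⊗ b₂ ∈ B_l ⊗ B_k`, let
`b₂' ∈ B_k`, `b₁' ∈ B_l` and `l', k', m` be produced by Rule (A): with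
`z = min(x_1(b₁), x̄_1(b₂))`, remove `z` letters `1` from `𝒯(b₁)` and `z` letters `1̄` from
`𝒯(b₂)`, column-insert the second word into the first obtaining the tableau `P` with second
row of length `m`, reverse-bump `l' - m` letters from the first row and then `m` letters from
the second row; `b₁'` has word `w_1 ⋯ w_{l'} 1̄^z` and `b₂'` has word `1^z T'`.  Then
`ι(b₁ ⊗ b₂) = b₂' ⊗ b₁'` and `H(b₁ ⊗ b₂) = 2 min(l',k') - m`. -/
theorem main_theorem_A
    (n l k : ℕ) (hn : 2 ≤ n) (hl : 1 ≤ l) (hk : 1 ≤ k)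
    (ι : Tup n × Tup n → Tup n × Tup n) (hι : IsIsoA n l k ι)
    (H : Tup n × Tup n → ℤ) (hH : IsEnergyA n l k ι H)
    (b1 b2 : Tup n) (hb1 : b1 ∈ BA n l) (hb2 : b2 ∈ BA n k)
    (z l' k' m : ℕ)
    (hz : z = min (xc b1 1) (xbc b2 1))
    (hl' : l' = l - z) (hk' : k' = k - z)
    (P : List (List ℕ))
    (hP : P = insertWord n ((rowWordA n b2).take (k - z))
                (rowCols ((rowWordA n b1).drop z)))
    (hm : m = numTwoCols P)
    (Q1 : List (List ℕ) × List ℕ) (hQ1 : Q1 = rbIter (rbFirst n) (l' - m) P)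
    (Q2 : List (List ℕ) × List ℕ) (hQ2 : Q2 = rbIter (rbSecond n) m Q1.1)
    (b1' b2' : Tup n) (hb1' : b1' ∈ BA n l) (hb2' : b2' ∈ BA n k)
    (hw1 : rowWordA n b1' = (Q1.2 ++ Q2.2) ++ List.replicate z (bar n 1))
    (hw2 : rowWordA n b2' = List.replicate z 1 ++ colsWord Q2.1) :
    ι (b1, b2) = (b2', b1') ∧
    H (b1, b2) = 2 * ((min l' k' : ℕ) : ℤ) - (m : ℤ) := by
  obtain ⟨r1, r2, r3⟩ := rule_A hn b1 b2 hb1 hb2 z l' k' m hz hl' hk' P hP hm Q1 hQ1 Q2 hQ2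
    b1' b2' hb1' hb2' hw1 hw2
  have hu : ((b1, b2) : T2 n) ∈ BA n l ×ˢ BA n k := ⟨hb1, hb2⟩
  refine ⟨iso_eq hn hι (b1, b2) (b2', b1') hu ⟨hb2', hb1'⟩ (fun d => (r2.trans r3) d), ?_⟩
  obtain ⟨a, c, d, s1, s2, s3, s4, s5⟩ := raise hn hH _ (b1, b2) rfl hu P r1 r2
  have s4' : d = z := by rw [s4, hz]; rfl
  have s5' : c = m := by rw [s5, hm]
  have h3 := H_hw hn hι hH (2 * min l k - 2 * d - c) a c d s1 s2 (by omega)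
  rw [s3, h3]
  omega
end KTT
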